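/- arXiv:2111.12662 — 3 statements merged into one kernel-verified Lean document; each statement's English description precedes it below -/
import Mathlib

section
/- Let χ be a non-principal Dirichlet character and assume GRH for χ, χχ₋₄, χ² and χ²χ₋₄. Fix c ∈ (0,1/8). If χ²χ₋₄ is principal, or if χ² is principal and L(1/2,χ)L(1/2,χχ₋₄) = 0, then there is a constant C = C(χ,c) such that for all x ≥ 2 and all sufficiently small r ∈ (0,1), |∫_{H_{1/2}} F(s,χ) x^s/s ds| ≤ C √x (x^r r^{5/4} + (log x)^{−5/4}). -/
open Complex Filter
open scoped Classical

noncomputable section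

/-- `n` is a sum of two squares. -/
def IsSum2Sq (n : ℕ) : Prop := ∃ a b : ℕ, n = a ^ 2 + b ^ 2

/-- The Dirichlet L-function `L(s,χ)` (junk value `0` if the modulus is `0`). -/
noncomputable def LVal {N : ℕ} (χ : DirichletCharacter ℂ N) (s : ℂ) : ℂ :=
  if h : N = 0 then 0 else
    haveI : NeZero N := ⟨h⟩
    DirichletCharacter.LFunction χ s

/-- GRH for `L(s,χ)`: all zeros with `0 < Re s < 1` have real part `1/2`. -/
def GRH {N : ℕ} (χ : DirichletCharacter ℂ N) : Prop :=
  ∀ s : ℂ, 0 < s.re → s.re < 1 → LVal χ s = 0 → s.re = 1 / 2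

/-- The unique non-principal Dirichlet character modulo 4. -/
noncomputable def chiNeg4 : DirichletCharacter ℂ 4 := ZMod.χ₄.ringHomComp (Int.castRingHom ℂ)

/-- The product `χ ⋅ χ₋₄`, as a Dirichlet character modulo `4q`. -/
noncomputable def mulChiNeg4 {q : ℕ} (χ : DirichletCharacter ℂ q) : DirichletCharacter ℂ (4 * q) :=
  DirichletCharacter.changeLevel (dvd_mul_left q 4) χ *
    DirichletCharacter.changeLevel (dvd_mul_right 4 q) chiNeg4

/-- `S(x;q,a)`, the number of sums of two squares `n ≤ x` with `n ≡ a (mod q)`. -/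
noncomputable def Scount (q a : ℕ) (x : ℝ) : ℕ :=
  ((Finset.Icc 1 ⌊x⌋₊).filter (fun m => IsSum2Sq m ∧ (m : ZMod q) = (a : ZMod q))).card

/-- The sequence `n ↦ 1_S(n) χ(n)`. -/
noncomputable def STwist {q : ℕ} (χ : DirichletCharacter ℂ q) (n : ℕ) : ℂ :=
  if IsSum2Sq n then χ (n : ZMod q) else 0

/-- `∑_{n ≤ x, n ∈ S} χ(n)`. -/
noncomputable def SSum {q : ℕ} (χ : DirichletCharacter ℂ q) (x : ℝ) : ℂ :=
  ∑ n ∈ Finset.Icc 1 ⌊x⌋₊, STwist χ n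

/-- A set of positive integers has natural density one. -/
def HasDensityOne (P : ℕ → Prop) : Prop :=
  Tendsto (fun n : ℕ => (((Finset.Icc 1 n).filter P).card : ℝ) / n) atTop (nhds 1)

/-- The integral of `f` over the truncated Hankel contour around `ρ`, with horizontal extent
`c` and radius `r`; the two horizontal segments are taken as boundary values from below
(lower segment, traversed rightwards, `arg(s-ρ) = -π`) and from above (upper segment,
traversed leftwards, `arg(s-ρ) = π`), and the circle `|s-ρ| = r` is traversed
anticlockwise. -/
noncomputable def hankelIntegral (f : ℂ → ℂ) (ρ : ℂ) (c r : ℝ) : ℂ :=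
  limUnder (nhdsWithin (0 : ℝ) (Set.Ioi 0)) (fun ε =>
    ((∫ σ in (ρ.re - c)..(ρ.re - r), f (σ + (ρ.im - ε) * I))
      + ∫ θ in (-Real.pi)..Real.pi, f (ρ + r * Complex.exp (θ * I)) * (I * r * Complex.exp (θ * I)))
      - ∫ σ in (ρ.re - c)..(ρ.re - r), f (σ + (ρ.im + ε) * I))

/-- The integral `∫ g(s) |ds|` of a nonnegative density `g` over the truncated Hankel
contour around `ρ` (horizontal extent `c`, radius `r`), horizontal segments again taken
as boundary values from below resp. above. -/
noncomputable def hankelAbsIntegral (g : ℂ → ℝ) (ρ : ℂ) (c r : ℝ) : ℝ :=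
  limUnder (nhdsWithin (0 : ℝ) (Set.Ioi 0)) (fun ε =>
    (∫ σ in (ρ.re - c)..(ρ.re - r), g (σ + (ρ.im - ε) * I))
      + (∫ θ in (-Real.pi)..Real.pi, g (ρ + r * Complex.exp (θ * I)) * r)
      + ∫ σ in (ρ.re - c)..(ρ.re - r), g (σ + (ρ.im + ε) * I))

/-- The constant `C_q` of the paper. -/
noncomputable def Cconst (q : ℕ) : ℝ :=
  (2 * Real.pi ^ (-(1 / 4 : ℝ)) / Real.Gamma (1 / 4)) *
    (∏' p : Nat.Primes, if (p : ℕ) % 4 = 3 then (1 - (p : ℝ) ^ (-(2:ℝ))) ^ (-(1 / 4 : ℝ)) else 1) *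
    ∏ p ∈ q.primeFactors.filter (fun p => p % 4 = 3), (1 - 1 / (p : ℝ)) ^ ((1 : ℝ) / 2)

theorem isSum2Sq_iff (n : ℕ) :
    IsSum2Sq n ↔ ∀ p ∈ n.primeFactors, p % 4 = 3 → Even (padicValNat p n) :=
  Nat.eq_sq_add_sq_iff

theorem isSum2Sq_mul_of_coprime {m n : ℕ} (h : m.Coprime n) :
    IsSum2Sq (m * n) ↔ IsSum2Sq m ∧ IsSum2Sq n := by
  rcases eq_or_ne m 0 with rfl | hm
  · have hn : n = 1 := by simpa using h
    subst hn
    simp [isSum2Sq_iff]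
  rcases eq_or_ne n 0 with rfl | hn
  · have hm : m = 1 := by simpa using h
    subst hm
    simp [isSum2Sq_iff]
  have key : ∀ {m n : ℕ}, m ≠ 0 → n ≠ 0 → m.Coprime n → ∀ p ∈ m.primeFactors,
      padicValNat p (m * n) = padicValNat p m := by
    intro m n hm hn h p hp
    have hpp := Nat.prime_of_mem_primeFactors hp
    have : Fact p.Prime := ⟨hpp⟩
    rw [padicValNat.mul hm hn, padicValNat.eq_zero_of_not_dvd (n := n), add_zero]
    intro hd
    exact hpp.one_lt.ne' (Nat.eq_one_of_dvd_coprimes h (Nat.dvd_of_mem_primeFactors hp) hd)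
  simp only [isSum2Sq_iff, Nat.primeFactors_mul hm hn, Finset.mem_union]
  constructor
  · refine fun H => ⟨fun p hp h3 => ?_, fun p hp h3 => ?_⟩
    · rw [← key hm hn h p hp]; exact H p (Or.inl hp) h3
    · rw [← key hn hm h.symm p hp, mul_comm]; exact H p (Or.inr hp) h3
  · rintro ⟨H1, H2⟩ p (hp | hp) h3
    · rw [key hm hn h p hp]; exact H1 p hp h3
    · rw [mul_comm, key hn hm h.symm p hp]; exact H2 p hp h3

theorem isSum2Sq_prime_pow {p : ℕ} (hp : p.Prime) (e : ℕ) :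
    IsSum2Sq (p ^ e) ↔ (p % 4 = 3 → Even e) := by
  have : Fact p.Prime := ⟨hp⟩
  rcases eq_or_ne e 0 with rfl | he
  · simp [isSum2Sq_iff]
  · simp [isSum2Sq_iff, Nat.primeFactors_prime_pow he hp]

/-- The indicator function of the positive integers composed of primes `≡ 3 (mod 4)`. -/
def threeModFourHom : ℕ →*₀ ℂ where
  toFun n := if n ≠ 0 ∧ ∀ p ∈ n.primeFactors, p % 4 = 3 then 1 else 0
  map_zero' := by simp
  map_one' := by simp
  map_mul' m n := by
    rcases eq_or_ne m 0 with rfl | hm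
    · simp
    rcases eq_or_ne n 0 with rfl | hn
    · simp
    have h : (m * n ≠ 0 ∧ ∀ p ∈ (m * n).primeFactors, p % 4 = 3) ↔
        (m ≠ 0 ∧ ∀ p ∈ m.primeFactors, p % 4 = 3) ∧
          (n ≠ 0 ∧ ∀ p ∈ n.primeFactors, p % 4 = 3) := by
      simp only [Nat.primeFactors_mul hm hn, Finset.mem_union, mul_ne_zero_iff]
      grind
    simp only [h]
    split_ifs <;> simp_all

theorem threeModFourHom_prime {p : ℕ} (hp : p.Prime) :
    threeModFourHom p = if p % 4 = 3 then 1 else 0 := by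
  simp only [threeModFourHom, MonoidWithZeroHom.coe_mk, ZeroHom.coe_mk, hp.primeFactors]
  simp [hp.ne_zero]

theorem norm_threeModFourHom_le_one (n : ℕ) : ‖threeModFourHom n‖ ≤ 1 := by
  simp only [threeModFourHom, MonoidWithZeroHom.coe_mk, ZeroHom.coe_mk]
  split_ifs <;> simp

theorem mulChiNeg4_apply_nat {q : ℕ} (χ : DirichletCharacter ℂ q) (n : ℕ) :
    mulChiNeg4 χ (n : ZMod (4 * q)) = χ n * chiNeg4 n := by
  by_cases h : n.Coprime (4 * q)
  · have hu : IsUnit (n : ZMod (4 * q)) := (ZMod.isUnit_iff_coprime n _).2 h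
    obtain ⟨u, hu⟩ := hu
    rw [← hu, mulChiNeg4, MulChar.mul_apply, DirichletCharacter.changeLevel_eq_cast_of_dvd,
      DirichletCharacter.changeLevel_eq_cast_of_dvd, hu]
    rw [ZMod.cast_natCast (dvd_mul_left q 4), ZMod.cast_natCast (dvd_mul_right 4 q)]
  · rw [MulChar.map_nonunit _ (by rwa [ZMod.isUnit_iff_coprime])]
    rw [Nat.coprime_mul_iff_right, not_and_or] at h
    rcases h with h | h
    · rw [chiNeg4.map_nonunit (by rwa [ZMod.isUnit_iff_coprime]), mul_zero]
    · rw [χ.map_nonunit (by rwa [ZMod.isUnit_iff_coprime]), zero_mul]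

theorem chiNeg4_apply_nat (n : ℕ) :
    chiNeg4 (n : ZMod 4) = if n % 2 = 0 then 0 else if n % 4 = 1 then 1 else -1 := by
  simp only [chiNeg4, MulChar.ringHomComp_apply, ZMod.χ₄_nat_eq_if_mod_four]
  split_ifs <;> simp

theorem mulChiNeg4_one_ne_one {q : ℕ} (hq : 0 < q) :
    mulChiNeg4 (1 : DirichletCharacter ℂ q) ≠ 1 := by
  intro h
  have h1 := mulChiNeg4_apply_nat (1 : DirichletCharacter ℂ q) (4 * q - 1)
  have hc : (4 * q - 1).Coprime (4 * q) := by
    have := (Nat.coprime_self_add_right (m := 4 * q - 1) (n := 1)).2 (by simp)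
    rwa [Nat.sub_add_cancel (by omega)] at this
  rw [h, MulChar.one_apply ((ZMod.isUnit_iff_coprime _ _).2 hc),
    MulChar.one_apply ((ZMod.isUnit_iff_coprime _ _).2 (Nat.Coprime.coprime_mul_left_right hc)),
    chiNeg4_apply_nat, if_neg (by omega), if_neg (by omega)] at h1
  norm_num at h1

theorem STwist_zero {q : ℕ} {χ : DirichletCharacter ℂ q} (hχ : χ ≠ 1) : STwist χ 0 = 0 := by
  have hq : q ≠ 1 := by
    rintro rfl
    exact hχ (Subsingleton.elim _ _)
  have : ¬ IsUnit ((0 : ℕ) : ZMod q) := by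
    rw [ZMod.isUnit_iff_coprime]; simpa using hq
  rw [STwist, χ.map_nonunit this, ite_self]

theorem norm_STwist_le_one {q : ℕ} (χ : DirichletCharacter ℂ q) (n : ℕ) : ‖STwist χ n‖ ≤ 1 := by
  rw [STwist]
  split_ifs
  · exact χ.norm_le_one _
  · simp

theorem norm_mul_prime_cpow_lt_one {q : ℕ} (χ : DirichletCharacter ℂ q) {p : ℕ} (hp : p.Prime)
    {s : ℂ} (hs : 0 < s.re) : ‖χ p * (p : ℂ) ^ (-s)‖ < 1 := by
  rw [norm_mul, Complex.norm_natCast_cpow_of_pos hp.pos, neg_re]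
  have h1 : (p : ℝ) ^ (-s.re) < 1 :=
    Real.rpow_lt_one_of_one_lt_of_neg (by exact_mod_cast hp.one_lt) (by linarith)
  have h2 := χ.norm_le_one (p : ZMod q)
  have h3 : 0 ≤ (p : ℝ) ^ (-s.re) := by positivity
  nlinarith [norm_nonneg (χ (p : ZMod q))]

theorem tsum_STwist_prime_pow {q : ℕ} (χ : DirichletCharacter ℂ q) {p : ℕ} (hp : p.Prime)
    {s : ℂ} (hs : 0 < s.re) :
    ∑' e : ℕ, STwist χ (p ^ e) * ((p ^ e : ℕ) : ℂ) ^ (-s) =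
      if p % 4 = 3 then (1 - (χ p * (p : ℂ) ^ (-s)) ^ 2)⁻¹ else (1 - χ p * (p : ℂ) ^ (-s))⁻¹ := by
  have hy := norm_mul_prime_cpow_lt_one χ hp hs
  have hterm : ∀ e : ℕ, STwist χ (p ^ e) * ((p ^ e : ℕ) : ℂ) ^ (-s) =
      if IsSum2Sq (p ^ e) then (χ p * (p : ℂ) ^ (-s)) ^ e else 0 := by
    intro e
    have : ((p ^ e : ℕ) : ℂ) ^ (-s) = ((p : ℂ) ^ (-s)) ^ e :=
      map_pow (riemannZetaSummandHom (s := s) (by rintro rfl; simp at hs)) p e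
    rw [STwist, this]
    split_ifs
    · push_cast; rw [map_pow, mul_pow]
    · simp
  set y := χ p * (p : ℂ) ^ (-s)
  simp_rw [hterm, isSum2Sq_prime_pow hp]
  split_ifs with h3
  · have h1 : HasSum (fun k : ℕ => if p % 4 = 3 → Even (2 * k) then y ^ (2 * k) else 0)
        (1 - y ^ 2)⁻¹ := by
      simp only [even_two_mul, implies_true, if_true, pow_mul]
      exact hasSum_geometric_of_norm_lt_one (by
        rw [norm_pow]; exact pow_lt_one₀ (norm_nonneg _) hy two_ne_zero)
    have h2 : HasSum (fun k : ℕ => if p % 4 = 3 → Even (2 * k + 1) then y ^ (2 * k + 1) else 0)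
        0 := by
      have h : ∀ k : ℕ, ¬ (p % 4 = 3 → Even (2 * k + 1)) := fun k h' => by
        have := h' h3
        grind
      simp only [h, if_false, hasSum_zero]
    rw [(HasSum.even_add_odd (f := fun e : ℕ => if p % 4 = 3 → Even e then y ^ e else 0)
      h1 h2).tsum_eq, add_zero]
  · simp only [h3, false_imp_iff, if_true]
    exact tsum_geometric_of_norm_lt_one hy

theorem hasProd_LSeries_STwist {q : ℕ} {χ : DirichletCharacter ℂ q} (hχ : χ ≠ 1)
    {s : ℂ} (hs : 1 < s.re) :
    HasProd (fun p : Nat.Primes => if (p : ℕ) % 4 = 3 then (1 - (χ p * (p : ℂ) ^ (-s)) ^ 2)⁻¹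
      else (1 - χ p * (p : ℂ) ^ (-s))⁻¹) (LSeries (STwist χ) s) := by
  have hs0 : s ≠ 0 := by rintro rfl; norm_num at hs
  have hterm : LSeries.term (STwist χ) s = fun n : ℕ => STwist χ n * (n : ℂ) ^ (-s) := by
    ext n
    rw [LSeries.term_of_ne_zero' hs0, cpow_neg, div_eq_mul_inv]
  have hsum : Summable (fun n : ℕ => ‖STwist χ n * (n : ℂ) ^ (-s)‖) := by
    have := (LSeriesSummable_of_bounded_of_one_lt_re (f := STwist χ) (m := 1)
      (fun n _ => norm_STwist_le_one χ n) hs).norm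
    rwa [hterm] at this
  have := EulerProduct.eulerProduct_hasProd (f := fun n : ℕ => STwist χ n * (n : ℂ) ^ (-s))
    (by
      have h1 : IsSum2Sq 1 := ⟨1, 0, by norm_num⟩
      simp [STwist, h1])
    (by
      intro m n hmn
      simp only [STwist, isSum2Sq_mul_of_coprime hmn, Nat.cast_mul, map_mul]
      rw [← ofReal_natCast m, ← ofReal_natCast n,
        mul_cpow_ofReal_nonneg m.cast_nonneg n.cast_nonneg]
      by_cases h1 : IsSum2Sq m <;> by_cases h2 : IsSum2Sq n <;> simp [h1, h2]
      ring)
    hsum (by simp [STwist_zero hχ])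
  rw [LSeries, hterm]
  convert! this using 2 with p
  rw [tsum_STwist_prime_pow χ p.2 (by linarith)]

theorem prime_euler_factor_identity {y : ℂ} (hy : ‖y‖ < 1) :
    (1 - y ^ 2)⁻¹ ^ 4 * (1 + y ^ 2)⁻¹ =
      (1 - y)⁻¹ ^ 2 * (1 + y)⁻¹ ^ 2 * (1 - y ^ 2)⁻¹ * (1 - y ^ 4)⁻¹ := by
  have h : ∀ z : ℂ, ‖z‖ < 1 → 1 - z ≠ 0 ∧ 1 + z ≠ 0 := by
    intro z hz
    refine ⟨fun h0 => ?_, fun h0 => ?_⟩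
    · rw [← sub_eq_zero.1 h0, norm_one] at hz; exact lt_irrefl _ hz
    · rw [eq_neg_of_add_eq_zero_right h0, norm_neg, norm_one] at hz; exact lt_irrefl _ hz
  obtain ⟨h1, h2⟩ := h y hy
  obtain ⟨h3, h4⟩ := h (y ^ 2) (by
    rw [norm_pow]; exact pow_lt_one₀ (norm_nonneg _) hy two_ne_zero)
  have h5 : 1 - y ^ 4 = (1 - y ^ 2) * (1 + y ^ 2) := by ring
  have h6 : 1 - y ^ 2 = (1 - y) * (1 + y) := by ring
  rw [h5, h6]
  field_simp

/-- The convergent factor `∏_{p ≡ 3 (mod 4)} (1 - χ(p)⁴ p^{-w})⁻¹`, as a Dirichlet series. -/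
def quarticFactor {q : ℕ} (χ : DirichletCharacter ℂ q) (w : ℂ) : ℂ :=
  LSeries (fun n => threeModFourHom n * χ n ^ 4) w

theorem norm_threeModFourHom_mul_le_one {q : ℕ} (χ : DirichletCharacter ℂ q) (n : ℕ) :
    ‖threeModFourHom n * χ n ^ 4‖ ≤ 1 := by
  rw [norm_mul, norm_pow]
  exact mul_le_one₀ (norm_threeModFourHom_le_one n) (by positivity)
    (pow_le_one₀ (norm_nonneg _) (χ.norm_le_one _))

theorem hasProd_quarticFactor {q : ℕ} (χ : DirichletCharacter ℂ q) {w : ℂ} (hw : 1 < w.re) :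
    HasProd (fun p : Nat.Primes => (1 - threeModFourHom p * χ p ^ 4 * (p : ℂ) ^ (-w))⁻¹)
      (quarticFactor χ w) := by
  have hw0 : w ≠ 0 := by rintro rfl; norm_num at hw
  have hterm : LSeries.term (fun n => threeModFourHom n * χ n ^ 4) w =
      fun n : ℕ => (threeModFourHom * dirichletSummandHom (χ ^ 4) hw0 : ℕ →*₀ ℂ) n := by
    ext n
    rw [LSeries.term_of_ne_zero' hw0]
    change _ = threeModFourHom n * dirichletSummandHom (χ ^ 4) hw0 n
    simp only [dirichletSummandHom, MonoidWithZeroHom.coe_mk, ZeroHom.coe_mk,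
      MulChar.pow_apply' _ (by norm_num : 4 ≠ 0), cpow_neg, div_eq_mul_inv, mul_assoc]
  have hsum := (LSeriesSummable_of_bounded_of_one_lt_re (m := 1)
    (fun n _ => norm_threeModFourHom_mul_le_one χ n) hw).norm
  rw [hterm] at hsum
  have := EulerProduct.eulerProduct_completely_multiplicative_hasProd hsum
  rw [quarticFactor, LSeries, hterm]
  convert! this using 4 with p
  change _ = threeModFourHom p * dirichletSummandHom (χ ^ 4) hw0 p
  simp [dirichletSummandHom, MulChar.pow_apply' _ (by norm_num : 4 ≠ 0), mul_assoc]

theorem differentiableAt_quarticFactor {q : ℕ} (χ : DirichletCharacter ℂ q) {w : ℂ}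
    (hw : 1 < w.re) : DifferentiableAt ℂ (quarticFactor χ) w := by
  refine (LSeries_differentiableOn _).differentiableAt ((isOpen_re_gt_EReal _).mem_nhds ?_)
  refine lt_of_le_of_lt (LSeries.abscissaOfAbsConv_le_of_le_const
    ⟨1, fun n _ => norm_threeModFourHom_mul_le_one χ n⟩) ?_
  exact_mod_cast hw

theorem hasProd_two_ite (a : ℂ) :
    HasProd (fun p : Nat.Primes => if (p : ℕ) = 2 then a else 1) a := by
  have h := hasProd_single (f := fun p : Nat.Primes => if (p : ℕ) = 2 then a else 1)
    ⟨2, Nat.prime_two⟩ (fun p hp => if_neg fun h => hp (Subtype.ext h))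
  exact h

/-- The Euler product factorization of `F(s,χ)⁴` into Dirichlet `L`-series. -/
theorem LSeries_STwist_pow_four {q : ℕ} {χ : DirichletCharacter ℂ q} (hχ : χ ≠ 1)
    {s : ℂ} (hs : 1 < s.re) :
    LSeries (STwist χ) s ^ 4 * LSeries (fun n => mulChiNeg4 (χ ^ 2) n) (2 * s) *
        (1 - χ 2 * 2 ^ (-s)) =
      LSeries (fun n => χ n) s ^ 2 * LSeries (fun n => mulChiNeg4 χ n) s ^ 2 *
        LSeries (fun n => (χ ^ 2) n) (2 * s) * quarticFactor χ (4 * s) *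
        (1 + χ 2 * 2 ^ (-s)) := by
  have hs2 : 1 < (2 * s).re := by simp; linarith
  have hs4 : 1 < (4 * s).re := by simp; linarith
  have e1 := hasProd_LSeries_STwist hχ hs
  have e2 := (mulChiNeg4 (χ ^ 2)).LSeries_eulerProduct_hasProd hs2
  have e3 := χ.LSeries_eulerProduct_hasProd hs
  have e4 := (mulChiNeg4 χ).LSeries_eulerProduct_hasProd hs
  have e5 := (χ ^ 2).LSeries_eulerProduct_hasProd hs2
  have e6 := hasProd_quarticFactor χ hs4
  have e7 := hasProd_two_ite (1 - χ 2 * 2 ^ (-s))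
  have e8 := hasProd_two_ite (1 + χ 2 * 2 ^ (-s))
  have l := ((((e1.mul e1).mul (e1.mul e1)).mul e2).mul e7)
  have r := (((((e3.mul e3).mul (e4.mul e4)).mul e5).mul e6).mul e8)
  have key := l.unique (a₂ := _) (by
    convert! r using 2 with p
    have hp := p.2
    have hy := norm_mul_prime_cpow_lt_one χ hp (s := s) (by linarith)
    have hpow : ∀ k : ℕ, (p : ℂ) ^ (-(k * s)) = ((p : ℂ) ^ (-s)) ^ k := fun k => by
      rw [← cpow_nat_mul]; ring_nf
    have hpow2 := hpow 2
    have hpow4 := hpow 4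
    push_cast at hpow2 hpow4
    have hy1 : 1 - χ p * (p : ℂ) ^ (-s) ≠ 0 := fun h0 => by
      rw [← sub_eq_zero.1 h0, norm_one] at hy; exact lt_irrefl _ hy
    have hy2 : 1 + χ p * (p : ℂ) ^ (-s) ≠ 0 := fun h0 => by
      rw [eq_neg_of_add_eq_zero_right h0, norm_neg, norm_one] at hy; exact lt_irrefl _ hy
    rw [hpow2, hpow4, mulChiNeg4_apply_nat, mulChiNeg4_apply_nat,
      MulChar.pow_apply' _ two_ne_zero, threeModFourHom_prime hp, chiNeg4_apply_nat]
    rcases hp.eq_two_or_odd with h2 | h2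
    · obtain ⟨p, hp'⟩ := p
      simp only at h2
      subst h2
      have h5 : 1 - (χ 2 * 2 ^ (-s)) ^ 2 = (1 - χ 2 * 2 ^ (-s)) * (1 + χ 2 * 2 ^ (-s)) := by ring
      simp only [Nat.cast_ofNat] at *
      simp [← mul_pow, h5]
      field_simp
    · have hp2 : (p : ℕ) ≠ 2 := by omega
      have h2' : ¬ (p : ℕ) % 2 = 0 := by omega
      by_cases h3 : (p : ℕ) % 4 = 3
      · have hk := prime_euler_factor_identity hy
        have h1 : ¬ (p : ℕ) % 4 = 1 := by omega
        simp only [if_neg hp2, if_neg h2', if_pos h3, if_neg h1, mul_neg, mul_one, neg_mul,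
          sub_neg_eq_add, one_mul, ← mul_pow]
        linear_combination hk
      · have h1 : (p : ℕ) % 4 = 1 := by omega
        simp only [if_neg hp2, if_neg h2', if_neg h3, if_pos h1, mul_one, ← mul_pow, zero_mul,
          sub_zero, inv_one])
  linear_combination key

theorem exists_tendsto_of_tendsto_pow {f : ℝ → ℂ} {δ : ℝ} (hδ : 0 < δ) {n : ℕ} (hn : n ≠ 0)
    (hf : ContinuousOn f (Set.Ioo 0 δ)) {w : ℂ}
    (hw : Tendsto (fun ε => f ε ^ n) (nhdsWithin 0 (Set.Ioi 0)) (nhds w)) :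
    ∃ ℓ, Tendsto f (nhdsWithin 0 (Set.Ioi 0)) (nhds ℓ) := by
  rcases eq_or_ne w 0 with rfl | hw0
  · refine ⟨0, ?_⟩
    have h := hw.norm
    rw [tendsto_zero_iff_norm_tendsto_zero]
    have h2 := h.rpow_const (p := ((n : ℝ)⁻¹)) (Or.inr (by positivity))
    rw [norm_zero, Real.zero_rpow (by positivity)] at h2
    refine h2.congr fun ε => ?_
    rw [norm_pow, Real.pow_rpow_inv_natCast (norm_nonneg _) hn]
  · have hg : Tendsto (fun ε => f ε ^ n / w) (nhdsWithin 0 (Set.Ioi 0)) (nhds 1) := by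
      simpa [hw0] using hw.div_const w
    have hslit : ∀ᶠ ε in nhdsWithin (0 : ℝ) (Set.Ioi 0), f ε ^ n / w ∈ slitPlane :=
      hg.eventually (isOpen_slitPlane.mem_nhds one_mem_slitPlane)
    obtain ⟨u, hu, hsub⟩ := (mem_nhdsGT_iff_exists_Ioo_subset).1 hslit
    have hu0 : 0 < u := hu
    set v := min u δ
    have hv : 0 < v := lt_min hu0 hδ
    set h : ℝ → ℂ := fun ε => cexp (Complex.log (f ε ^ n / w) / n) with hh
    have hcont : ContinuousOn h (Set.Ioo 0 v) := by
      have h1 : ContinuousOn f (Set.Ioo 0 v) :=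
        hf.mono (Set.Ioo_subset_Ioo_right (min_le_right _ _))
      refine ContinuousOn.cexp (ContinuousOn.div_const (ContinuousOn.clog
        ((h1.pow n).div_const w) ?_) _)
      exact fun ε hε => hsub ⟨hε.1, hε.2.trans_le (min_le_left _ _)⟩
    have hpow : ∀ ε ∈ Set.Ioo 0 v, h ε ^ n = f ε ^ n / w := by
      intro ε hε
      have hs : f ε ^ n / w ∈ slitPlane := hsub ⟨hε.1, hε.2.trans_le (min_le_left _ _)⟩
      rw [hh, ← Complex.exp_nat_mul, mul_div_cancel₀ _ (by exact_mod_cast hn),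
        Complex.exp_log (slitPlane_ne_zero hs)]
    have hfin : Set.Finite {z : ℂ | z ^ n = w} := by
      refine (Polynomial.nthRoots n w).toFinset.finite_toSet.subset fun z hz => ?_
      simpa [Polynomial.mem_nthRoots (Nat.pos_of_ne_zero hn)] using hz
    obtain ⟨k, -, hk⟩ := isPreconnected_Ioo.eqOn_const_of_mapsTo (S := Set.Ioo 0 v)
      (f := fun ε => f ε / h ε) hfin.isDiscrete
      ((hf.mono (Set.Ioo_subset_Ioo_right (min_le_right _ _))).div hcont
        fun ε _ => Complex.exp_ne_zero _)
      (fun ε hε => by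
        have hs : f ε ^ n / w ≠ 0 :=
          slitPlane_ne_zero (hsub ⟨hε.1, hε.2.trans_le (min_le_left _ _)⟩)
        have h3 : f ε ^ n ≠ 0 := fun h0 => hs (by rw [h0, zero_div])
        change (f ε / h ε) ^ n = w
        rw [div_pow, hpow ε hε]
        field_simp)
      ⟨w ^ ((n : ℂ)⁻¹), Complex.cpow_nat_inv_pow w hn⟩
    have hlim : Tendsto h (nhdsWithin 0 (Set.Ioi 0)) (nhds (cexp (Complex.log 1 / n))) :=
      ((hg.clog one_mem_slitPlane).div_const _).cexp
    refine ⟨k * cexp (Complex.log 1 / n), (hlim.const_mul k).congr' ?_⟩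
    filter_upwards [Ioo_mem_nhdsGT hv] with ε hε
    have := hk hε
    simp only [Function.const_apply] at this
    rw [← this, div_mul_cancel₀ _ (Complex.exp_ne_zero _)]

theorem integral_rpow_mul_rpow_le {x c r : ℝ} (hx : 1 < x) (hr : 0 < r) (hrc : r ≤ c) :
    ∫ σ in (1 / 2 - c)..(1 / 2 - r), (1 / 2 - σ) ^ (1 / 4 : ℝ) * x ^ σ ≤
      Real.Gamma (5 / 4) * (√x * Real.log x ^ (-(5 : ℝ) / 4)) := by
  have hlog := Real.log_pos hx
  have hx0 : 0 < x := by linarith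
  have hG := Real.integral_rpow_mul_exp_neg_mul_Ioi (a := 5 / 4) (by norm_num) hlog
  have hpos : 0 < (1 / Real.log x) ^ (5 / 4 : ℝ) * Real.Gamma (5 / 4) :=
    mul_pos (by positivity) (Real.Gamma_pos_of_pos (by norm_num))
  have hint := not_imp_comm.1 MeasureTheory.integral_undef (hG.trans_ne hpos.ne')
  have hsub := intervalIntegral.integral_comp_sub_left (a := 1 / 2 - c) (b := 1 / 2 - r)
    (fun u : ℝ => u ^ (1 / 4 : ℝ) * x ^ (1 / 2 - u)) (1 / 2)
  simp only [sub_sub_cancel] at hsub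
  rw [hsub, intervalIntegral.integral_of_le hrc]
  have heq : ∀ u : ℝ, u ^ (1 / 4 : ℝ) * x ^ (1 / 2 - u) =
      √x * (u ^ ((5 / 4 : ℝ) - 1) * Real.exp (-(Real.log x * u))) := by
    intro u
    rw [sub_eq_add_neg, Real.rpow_add hx0, ← Real.sqrt_eq_rpow, Real.rpow_def_of_pos hx0]
    norm_num
    ring
  simp only [heq]
  rw [MeasureTheory.integral_const_mul]
  have hle : ∫ u in Set.Ioc r c, u ^ ((5 / 4 : ℝ) - 1) * Real.exp (-(Real.log x * u)) ≤
      (1 / Real.log x) ^ (5 / 4 : ℝ) * Real.Gamma (5 / 4) := by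
    rw [← hG]
    refine MeasureTheory.setIntegral_mono_set hint ?_ ?_
    · filter_upwards [MeasureTheory.ae_restrict_mem measurableSet_Ioi] with u hu
      have : (0 : ℝ) < u := hu
      simp only [Pi.zero_apply]
      positivity
    · exact LE.le.eventuallyLE fun u hu => hr.trans hu.1
  have h5 : (1 / Real.log x) ^ (5 / 4 : ℝ) = Real.log x ^ (-(5 : ℝ) / 4) := by
    rw [one_div, Real.inv_rpow hlog.le, ← Real.rpow_neg hlog.le, neg_div]
  rw [h5] at hle
  calc _ ≤ √x * (Real.log x ^ (-(5 : ℝ) / 4) * Real.Gamma (5 / 4)) := by gcongr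
    _ = _ := by ring

theorem norm_mul_cpow_div_le {F : ℂ → ℂ} {A x : ℝ} {s : ℂ} (hx : 0 < x) (hs : 3 / 8 ≤ s.re)
    (hF : ‖F s‖ ≤ A) : ‖F s * (x : ℂ) ^ s / s‖ ≤ 8 / 3 * (A * x ^ s.re) := by
  have h1 : 3 / 8 ≤ ‖s‖ := hs.trans (Complex.re_le_norm s)
  rw [norm_div, norm_mul, Complex.norm_cpow_eq_rpow_re_of_pos hx, div_le_iff₀ (by linarith)]
  have h2 : ‖F s‖ * x ^ s.re ≤ A * x ^ s.re := by gcongr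
  have h3 : 0 ≤ ‖F s‖ * x ^ s.re := by positivity
  nlinarith

/-- The limiting integral along one side of the cut exists and is `O(√x (log x)^{-5/4})`. -/
theorem exists_tendsto_horizontal_integral {F : ℂ → ℂ} {c δ B x r η : ℝ} (hc1 : c < 1 / 8)
    (hδ : 0 < δ) (hB : 0 ≤ B) (hx : 2 ≤ x) (hr : 0 < r) (hrc : r ≤ c) (hη : |η| = 1)
    (hcont : ContinuousOn F {s | 3 / 8 < s.re ∧ s.im ≠ 0 ∧ |s.im| < δ})
    (hbd : ∀ s : ℂ, 1 / 2 - c ≤ s.re → s.re < 1 / 2 + δ → s.im ≠ 0 → |s.im| < δ →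
      ‖F s‖ ≤ B * ‖s - 1 / 2‖ ^ (1 / 4 : ℝ))
    (hlim : ∀ σ : ℝ, 1 / 2 - c ≤ σ → σ < 1 / 2 → ∃ w, Tendsto
      (fun ε : ℝ => F (σ + (η * ε : ℝ) * I) ^ 4) (nhdsWithin 0 (Set.Ioi 0)) (nhds w)) :
    ∃ J : ℂ, Tendsto (fun ε : ℝ => ∫ σ in (1 / 2 - c)..(1 / 2 - r),
        F (σ + (η * ε : ℝ) * I) * (x : ℂ) ^ (σ + (η * ε : ℝ) * I) / (σ + (η * ε : ℝ) * I))
        (nhdsWithin 0 (Set.Ioi 0)) (nhds J) ∧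
      ‖J‖ ≤ 8 / 3 * B * Real.Gamma (5 / 4) * (√x * Real.log x ^ (-(5 : ℝ) / 4)) := by
  have hx0 : 0 < x := by linarith
  have hη0 : η ≠ 0 := by rintro rfl; simp at hη
  have hre : ∀ σ ε : ℝ, ((σ : ℂ) + (η * ε : ℝ) * I).re = σ := fun σ ε => by simp
  have him : ∀ σ ε : ℝ, ((σ : ℂ) + (η * ε : ℝ) * I).im = η * ε := fun σ ε => by simp
  have hmem : ∀ σ ε : ℝ, 1 / 2 - c ≤ σ → ε ∈ Set.Ioo 0 δ →
      (σ : ℂ) + (η * ε : ℝ) * I ∈ {s : ℂ | 3 / 8 < s.re ∧ s.im ≠ 0 ∧ |s.im| < δ} := by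
    intro σ ε hσ hε
    refine ⟨by rw [hre]; linarith, by rw [him]; exact mul_ne_zero hη0 hε.1.ne', ?_⟩
    rw [him, abs_mul, hη, one_mul, abs_of_pos hε.1]
    exact hε.2
  have hl : ∀ σ : ℝ, ∃ ℓ : ℂ, 1 / 2 - c ≤ σ → σ < 1 / 2 →
      Tendsto (fun ε : ℝ => F (σ + (η * ε : ℝ) * I)) (nhdsWithin 0 (Set.Ioi 0)) (nhds ℓ) := by
    intro σ
    by_cases h : 1 / 2 - c ≤ σ ∧ σ < 1 / 2
    · obtain ⟨w, hw⟩ := hlim σ h.1 h.2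
      obtain ⟨ℓ, hℓ⟩ := exists_tendsto_of_tendsto_pow hδ four_ne_zero
        (hcont.comp (f := fun ε : ℝ => (σ : ℂ) + (η * ε : ℝ) * I) (by fun_prop)
          fun ε hε => hmem σ ε h.1 hε) hw
      exact ⟨ℓ, fun _ _ => hℓ⟩
    · exact ⟨0, fun h1 h2 => absurd ⟨h1, h2⟩ h⟩
  choose ℓ hℓ using hl
  have hzlim : ∀ σ : ℝ, Tendsto (fun ε : ℝ => (σ : ℂ) + (η * ε : ℝ) * I)
      (nhdsWithin 0 (Set.Ioi 0)) (nhds σ) := by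
    intro σ
    have : ContinuousAt (fun ε : ℝ => (σ : ℂ) + (η * ε : ℝ) * I) 0 := by fun_prop
    simpa using this.tendsto.mono_left nhdsWithin_le_nhds
  have hFbd : ∀ σ ε : ℝ, 1 / 2 - c ≤ σ → σ < 1 / 2 → ε ∈ Set.Ioo 0 δ →
      ‖F (σ + (η * ε : ℝ) * I)‖ ≤ B * ‖(σ + (η * ε : ℝ) * I : ℂ) - 1 / 2‖ ^ (1 / 4 : ℝ) := by
    intro σ ε h1 h2 hε
    obtain ⟨-, h3, h4⟩ := hmem σ ε h1 hε
    exact hbd _ (by rwa [hre]) (by rw [hre]; linarith) h3 h4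
  have hℓbd : ∀ σ : ℝ, 1 / 2 - c ≤ σ → σ < 1 / 2 →
      ‖ℓ σ‖ ≤ B * (1 / 2 - σ) ^ (1 / 4 : ℝ) := by
    intro σ h1 h2
    have h3 : Tendsto (fun ε : ℝ => B * ‖(σ + (η * ε : ℝ) * I : ℂ) - 1 / 2‖ ^ (1 / 4 : ℝ))
        (nhdsWithin 0 (Set.Ioi 0)) (nhds (B * ‖(σ : ℂ) - 1 / 2‖ ^ (1 / 4 : ℝ))) :=
      (((hzlim σ).sub_const _).norm.rpow_const (Or.inr (by norm_num))).const_mul B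
    have h4 : ‖(σ : ℂ) - 1 / 2‖ = 1 / 2 - σ := by
      rw [show (σ : ℂ) - 1 / 2 = ((σ - 1 / 2 : ℝ) : ℂ) by push_cast; ring, Complex.norm_real,
        Real.norm_eq_abs, abs_of_neg (by linarith)]
      ring
    rw [h4] at h3
    refine le_of_tendsto_of_tendsto (hℓ σ h1 h2).norm h3 ?_
    filter_upwards [Ioo_mem_nhdsGT hδ] with ε hε using hFbd σ ε h1 h2 hε
  have hab : (1 / 2 - c : ℝ) ≤ 1 / 2 - r := by linarith
  refine ⟨∫ σ in (1 / 2 - c)..(1 / 2 - r), ℓ σ * (x : ℂ) ^ (σ : ℂ) / σ, ?_, ?_⟩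
  · refine intervalIntegral.tendsto_integral_filter_of_dominated_convergence
      (fun _ => 8 / 3 * (B * x)) ?_ ?_ intervalIntegrable_const ?_
    · filter_upwards [Ioo_mem_nhdsGT hδ] with ε hε
      rw [Set.uIoc_of_le hab]
      refine ContinuousOn.aestronglyMeasurable ?_ measurableSet_Ioc
      have h0 : ∀ σ ∈ Set.Ioc (1 / 2 - c) (1 / 2 - r), (σ : ℂ) + (η * ε : ℝ) * I ≠ 0 := by
        intro σ hσ h
        have := hre σ ε
        rw [h, zero_re] at this
        linarith [hσ.1]
      refine ContinuousOn.div (ContinuousOn.mul ?_ ?_) (by fun_prop) h0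
      · exact hcont.comp (by fun_prop) fun σ hσ => hmem σ ε hσ.1.le hε
      · refine ContinuousOn.const_cpow (by fun_prop) (Or.inl ?_)
        exact_mod_cast hx0.ne'
    · filter_upwards [Ioo_mem_nhdsGT hδ, Ioo_mem_nhdsGT (show (0 : ℝ) < 1 / 2 by norm_num)]
        with ε hε hε2
      refine Eventually.of_forall fun σ hσ => ?_
      rw [Set.uIoc_of_le hab] at hσ
      have h2 : σ < 1 / 2 := by linarith [hσ.2]
      have hF1 : ‖F (σ + (η * ε : ℝ) * I)‖ ≤ B := by
        refine (hFbd σ ε hσ.1.le h2 hε).trans (mul_le_of_le_one_right hB ?_)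
        refine Real.rpow_le_one (norm_nonneg _) ?_ (by norm_num)
        refine (Complex.norm_le_abs_re_add_abs_im _).trans ?_
        simp only [sub_re, sub_im, hre, him]
        norm_num
        rw [abs_of_neg (by linarith), hη, abs_of_pos hε.1]
        linarith [hσ.1, hε2.2]
      refine (norm_mul_cpow_div_le hx0 (by rw [hre]; linarith [hσ.1]) hF1).trans ?_
      rw [hre]
      gcongr
      calc x ^ σ ≤ x ^ (1 : ℝ) := Real.rpow_le_rpow_of_exponent_le (by linarith) (by linarith)
        _ = x := Real.rpow_one x
    · refine Eventually.of_forall fun σ hσ => ?_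
      rw [Set.uIoc_of_le hab] at hσ
      have hσ0 : (σ : ℂ) ≠ 0 := by
        have : 0 < σ := by linarith [hσ.1]
        exact_mod_cast this.ne'
      refine ((hℓ σ hσ.1.le (by linarith [hσ.2])).mul ?_).div (hzlim σ) hσ0
      refine (hzlim σ).const_cpow (Or.inl ?_)
      exact_mod_cast hx0.ne'
  · refine (intervalIntegral.norm_integral_le_of_norm_le hab (g := fun σ =>
      8 / 3 * B * ((1 / 2 - σ) ^ (1 / 4 : ℝ) * x ^ σ)) ?_ ?_).trans ?_
    · refine Eventually.of_forall fun σ hσ => ?_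
      have h := norm_mul_cpow_div_le (F := fun _ => ℓ σ) (s := σ) hx0
        (by rw [ofReal_re]; linarith [hσ.1]) (hℓbd σ hσ.1.le (by linarith [hσ.2]))
      rw [ofReal_re] at h
      linarith
    · refine ContinuousOn.intervalIntegrable ?_
      refine ContinuousOn.mul continuousOn_const (ContinuousOn.mul ?_ ?_)
      · exact ContinuousOn.rpow_const (by fun_prop) fun _ _ => Or.inr (by norm_num)
      · exact ContinuousOn.rpow continuousOn_const continuousOn_id fun _ _ => Or.inl hx0.ne'
    · rw [intervalIntegral.integral_const_mul]
      have := integral_rpow_mul_rpow_le (x := x) (by linarith) hr hrc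
      have h8 : 0 ≤ 8 / 3 * B := by positivity
      nlinarith [mul_le_mul_of_nonneg_left this h8]

theorem norm_circle_integral_le {F : ℂ → ℂ} {c δ B x r : ℝ} (hc1 : c < 1 / 8)
    (hx : 2 ≤ x) (hr : 0 < r) (hrc : r ≤ c) (hrδ : r < δ)
    (hbd : ∀ s : ℂ, 1 / 2 - c ≤ s.re → s.re < 1 / 2 + δ → s.im ≠ 0 → |s.im| < δ →
      ‖F s‖ ≤ B * ‖s - 1 / 2‖ ^ (1 / 4 : ℝ)) :
    ‖∫ θ in (-Real.pi)..Real.pi, F (1 / 2 + r * cexp (θ * I)) *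
        (x : ℂ) ^ (1 / 2 + r * cexp (θ * I)) / (1 / 2 + r * cexp (θ * I)) *
        (I * r * cexp (θ * I))‖ ≤
      16 / 3 * Real.pi * B * (√x * (x ^ r * r ^ (5 / 4 : ℝ))) := by
  have hx0 : 0 < x := by linarith
  have hre : ∀ θ : ℝ, (1 / 2 + r * cexp (θ * I) : ℂ).re = 1 / 2 + r * Real.cos θ := by
    intro θ
    rw [add_re, re_ofReal_mul, exp_ofReal_mul_I_re]
    norm_num
  have him : ∀ θ : ℝ, (1 / 2 + r * cexp (θ * I) : ℂ).im = r * Real.sin θ := by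
    intro θ
    rw [add_im, im_ofReal_mul, exp_ofReal_mul_I_im]
    norm_num
  have hnorm : ∀ θ : ℝ, ‖(1 / 2 + r * cexp (θ * I) : ℂ) - 1 / 2‖ = r := by
    intro θ
    rw [add_sub_cancel_left, norm_mul, norm_exp_ofReal_mul_I, mul_one, norm_real,
      Real.norm_of_nonneg hr.le]
  have hbound : ∀ θ : ℝ, Real.sin θ ≠ 0 → ‖F (1 / 2 + r * cexp (θ * I)) *
        (x : ℂ) ^ (1 / 2 + r * cexp (θ * I)) / (1 / 2 + r * cexp (θ * I)) *
        (I * r * cexp (θ * I))‖ ≤ 8 / 3 * (B * r ^ (1 / 4 : ℝ) * (√x * x ^ r)) * r := by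
    intro θ hθ
    have hs1 : |Real.sin θ| ≤ 1 := Real.abs_sin_le_one θ
    have hc2 := Real.neg_one_le_cos θ
    have hc3 := Real.cos_le_one θ
    have h1 := hbd (1 / 2 + r * cexp (θ * I)) (by rw [hre]; nlinarith) (by rw [hre]; nlinarith)
      (by rw [him]; exact mul_ne_zero hr.ne' hθ)
      (by rw [him, abs_mul, abs_of_pos hr]; nlinarith)
    rw [hnorm] at h1
    have h2 := norm_mul_cpow_div_le hx0 (by rw [hre]; nlinarith) h1
    have h0 : 0 ≤ B * r ^ (1 / 4 : ℝ) := (norm_nonneg _).trans h1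
    have h3 : x ^ ((1 / 2 + r * cexp (θ * I) : ℂ).re) ≤ √x * x ^ r := by
      rw [hre, Real.sqrt_eq_rpow, ← Real.rpow_add hx0]
      exact Real.rpow_le_rpow_of_exponent_le (by linarith) (by nlinarith)
    rw [norm_mul, norm_mul (I * r), norm_mul I, norm_I, norm_exp_ofReal_mul_I, norm_real,
      Real.norm_of_nonneg hr.le, one_mul, mul_one]
    refine mul_le_mul_of_nonneg_right (h2.trans ?_) hr.le
    gcongr
  have hae : ∀ᵐ θ : ℝ, Real.sin θ ≠ 0 := by
    have : {θ : ℝ | Real.sin θ = 0}.Countable := by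
      refine (Set.countable_range fun n : ℤ => (n * Real.pi : ℝ)).mono fun θ hθ => ?_
      obtain ⟨n, hn⟩ := Real.sin_eq_zero_iff.1 hθ
      exact ⟨n, hn⟩
    filter_upwards [this.ae_notMem MeasureTheory.volume] with θ hθ using hθ
  refine (intervalIntegral.norm_integral_le_of_norm_le_const_ae (by
    filter_upwards [hae] with θ hθ _ using hbound θ hθ)).trans (le_of_eq ?_)
  have h5 : r ^ (5 / 4 : ℝ) = r ^ (1 / 4 : ℝ) * r := by
    rw [show (5 / 4 : ℝ) = 1 / 4 + 1 by norm_num, Real.rpow_add hr, Real.rpow_one]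
  rw [h5, sub_neg_eq_add, abs_of_pos (by linarith [Real.pi_pos])]
  ring

/-- A function of size `O(|s - 1/2|^{1/4})` off the real axis has a small integral over a
truncated Hankel contour around `1/2`. -/
theorem norm_hankelIntegral_half_le {F : ℂ → ℂ} {c δ B x r : ℝ} (hc1 : c < 1 / 8)
    (hδ : 0 < δ) (hB : 0 ≤ B) (hx : 2 ≤ x) (hr : 0 < r) (hrc : r ≤ c) (hrδ : r < δ)
    (hcont : ContinuousOn F {s | 3 / 8 < s.re ∧ s.im ≠ 0 ∧ |s.im| < δ})
    (hbd : ∀ s : ℂ, 1 / 2 - c ≤ s.re → s.re < 1 / 2 + δ → s.im ≠ 0 → |s.im| < δ →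
      ‖F s‖ ≤ B * ‖s - 1 / 2‖ ^ (1 / 4 : ℝ))
    (hlim : ∀ η : ℝ, |η| = 1 → ∀ σ : ℝ, 1 / 2 - c ≤ σ → σ < 1 / 2 → ∃ w, Tendsto
      (fun ε : ℝ => F (σ + (η * ε : ℝ) * I) ^ 4) (nhdsWithin 0 (Set.Ioi 0)) (nhds w)) :
    ‖hankelIntegral (fun s => F s * (x : ℂ) ^ s / s) (1 / 2) c r‖ ≤
      16 / 3 * B * (Real.pi + Real.Gamma (5 / 4)) * √x *
        (x ^ r * r ^ ((5 : ℝ) / 4) + Real.log x ^ (-(5 : ℝ) / 4)) := by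
  obtain ⟨J₁, hJ₁, hb₁⟩ := exists_tendsto_horizontal_integral hc1 hδ hB hx hr hrc
    (η := -1) (by simp) hcont hbd (hlim _ (by simp))
  obtain ⟨J₂, hJ₂, hb₂⟩ := exists_tendsto_horizontal_integral hc1 hδ hB hx hr hrc
    (η := 1) (by simp) hcont hbd (hlim _ (by simp))
  have hcirc := norm_circle_integral_le hc1 hx hr hrc hrδ hbd
  set K := ∫ θ in (-Real.pi)..Real.pi, F (1 / 2 + r * cexp (θ * I)) *
        (x : ℂ) ^ (1 / 2 + r * cexp (θ * I)) / (1 / 2 + r * cexp (θ * I)) *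
        (I * r * cexp (θ * I))
  have hH : hankelIntegral (fun s => F s * (x : ℂ) ^ s / s) (1 / 2) c r = J₁ + K - J₂ := by
    refine Tendsto.limUnder_eq (((hJ₁.add_const K).sub hJ₂).congr fun ε => ?_)
    have e1 : (1 / 2 : ℂ).re = 1 / 2 := by norm_num
    have e2 : (1 / 2 : ℂ).im = 0 := by norm_num
    simp only [e1, e2, ofReal_zero, zero_sub, zero_add, neg_mul, one_mul, ofReal_neg]
    rfl
  rw [hH]
  have hlogpos : 0 ≤ √x * Real.log x ^ (-(5 : ℝ) / 4) :=
    mul_nonneg (Real.sqrt_nonneg _) (Real.rpow_nonneg (Real.log_nonneg (by linarith)) _)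
  have hG : 0 < Real.Gamma (5 / 4) := Real.Gamma_pos_of_pos (by norm_num)
  have hrpos : 0 ≤ √x * (x ^ r * r ^ (5 / 4 : ℝ)) := by positivity
  have h := (norm_sub_le (J₁ + K) J₂).trans (add_le_add_left (norm_add_le J₁ K) _)
  have t1 : 0 ≤ B * Real.pi * (√x * Real.log x ^ (-(5 : ℝ) / 4)) := by positivity
  have t2 : 0 ≤ B * Real.Gamma (5 / 4) * (√x * (x ^ r * r ^ (5 / 4 : ℝ))) := by positivity
  linarith

/-- If `E(s) / (s - 1/2)` has a limit at each point of `[1/2 - c, 1/2]`, then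
`E(s) = O(|s - 1/2|)` uniformly near this segment, off the real axis. -/
theorem exists_norm_le_mul_norm_sub_half {E : ℂ → ℂ} {c : ℝ} (hc0 : 0 < c)
    (hE : ∀ σ : ℝ, 1 / 2 - c ≤ σ → σ ≤ 1 / 2 → ∃ w, Tendsto (fun s => E s / (s - 1 / 2))
      (nhdsWithin (σ : ℂ) {(σ : ℂ)}ᶜ) (nhds w)) :
    ∃ M δ : ℝ, 0 ≤ M ∧ 0 < δ ∧ ∀ s : ℂ, 1 / 2 - c ≤ s.re → s.re < 1 / 2 + δ → s.im ≠ 0 →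
      |s.im| < δ → ‖E s‖ ≤ M * ‖s - 1 / 2‖ := by
  set K : Set ℂ := (fun σ : ℝ => (σ : ℂ)) '' Set.Icc (1 / 2 - c) (1 / 2) with hKdef
  have hK : IsCompact K := isCompact_Icc.image continuous_ofReal
  have key : ∃ M : ℝ, ∀ᶠ s in nhdsSet K, s.im ≠ 0 → ‖E s‖ ≤ M * ‖s - 1 / 2‖ := by
    refine hK.induction_on (p := fun T => ∃ M : ℝ, ∀ᶠ s in nhdsSet T,
      s.im ≠ 0 → ‖E s‖ ≤ M * ‖s - 1 / 2‖) ?_ ?_ ?_ ?_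
    · exact ⟨0, by simp⟩
    · rintro S T hST ⟨M, hM⟩
      exact ⟨M, hM.filter_mono (nhdsSet_mono hST)⟩
    · rintro S T ⟨M₁, h₁⟩ ⟨M₂, h₂⟩
      refine ⟨max M₁ M₂, ?_⟩
      rw [nhdsSet_union, eventually_sup]
      constructor
      · filter_upwards [h₁] with s hs him
        refine (hs him).trans ?_
        gcongr
        exact le_max_left _ _
      · filter_upwards [h₂] with s hs him
        refine (hs him).trans ?_
        gcongr
        exact le_max_right _ _
    · rintro _ ⟨σ, hσ, rfl⟩
      obtain ⟨w, hw⟩ := hE σ hσ.1 hσ.2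
      have h1 : ∀ᶠ s in nhdsWithin (σ : ℂ) {(σ : ℂ)}ᶜ, ‖E s / (s - 1 / 2)‖ < ‖w‖ + 1 :=
        hw.norm.eventually_lt_const (lt_add_one _)
      have h2 : ∀ᶠ s in nhds (σ : ℂ), s.im ≠ 0 → ‖E s‖ ≤ (‖w‖ + 1) * ‖s - 1 / 2‖ := by
        filter_upwards [eventually_nhdsWithin_iff.1 h1] with s hs him
        have hne : ∀ t : ℝ, s ≠ t := by
          rintro t rfl
          simp at him
        have h3 : s - 1 / 2 ≠ 0 := by
          have := hne (1 / 2)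
          push_cast at this
          exact sub_ne_zero.2 this
        have h4 := (hs (hne σ)).le
        rwa [norm_div, div_le_iff₀ (norm_pos_iff.2 h3)] at h4
      refine ⟨_, mem_nhdsWithin_of_mem_nhds h2.eventually_nhds, ‖w‖ + 1, ?_⟩
      exact eventually_nhdsSet_iff_forall.2 fun y hy => hy
  obtain ⟨M, hM⟩ := key
  obtain ⟨d, hd, hsub⟩ := (Metric.hasBasis_nhdsSet_thickening hK).mem_iff.1 hM
  refine ⟨max M 0, d / 2, le_max_right _ _, by positivity, fun s h1 h2 h3 h4 => ?_⟩
  have hs : s ∈ Metric.thickening d K := by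
    rw [Metric.mem_thickening_iff]
    refine ⟨((min s.re (1 / 2) : ℝ) : ℂ), ⟨_, ⟨le_min h1 (by linarith), min_le_right _ _⟩, rfl⟩, ?_⟩
    rw [Complex.dist_eq]
    refine (Complex.norm_le_abs_re_add_abs_im _).trans_lt ?_
    rw [sub_re, sub_im, ofReal_re, ofReal_im, sub_zero]
    have h5 : |s.re - min s.re (1 / 2)| < d / 2 := by
      rcases le_total s.re (1 / 2) with h | h
      · rw [min_eq_left h, sub_self, abs_zero]
        linarith
      · rw [min_eq_right h, abs_of_nonneg (by linarith)]
        linarith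
    linarith
  refine (hsub hs h3).trans ?_
  gcongr
  exact le_max_left _ _

theorem exists_norm_hankelIntegral_half_le {F E : ℂ → ℂ} {c δ : ℝ} (hc0 : 0 < c)
    (hc1 : c < 1 / 8) (hδ : 0 < δ)
    (hcont : ContinuousOn F {s | 3 / 8 < s.re ∧ s.im ≠ 0 ∧ |s.im| < δ})
    (hFE : ∀ s : ℂ, 3 / 8 < s.re → s.im ≠ 0 → |s.im| < δ → F s ^ 4 = E s)
    (hE : ∀ σ : ℝ, 1 / 2 - c ≤ σ → σ ≤ 1 / 2 → ∃ w, Tendsto (fun s => E s / (s - 1 / 2))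
      (nhdsWithin (σ : ℂ) {(σ : ℂ)}ᶜ) (nhds w)) :
    ∃ C : ℝ, ∀ x : ℝ, 2 ≤ x → ∃ r₀ : ℝ, 0 < r₀ ∧ ∀ r : ℝ, 0 < r → r < r₀ →
      ‖hankelIntegral (fun s => F s * (x : ℂ) ^ s / s) (1 / 2) c r‖
        ≤ C * √x * (x ^ r * r ^ ((5 : ℝ) / 4) + Real.log x ^ (-(5 : ℝ) / 4)) := by
  obtain ⟨M, δ₁, hM0, hδ₁, hM⟩ := exists_norm_le_mul_norm_sub_half hc0 hE
  set δ₂ := min δ δ₁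
  have hδ₂ : 0 < δ₂ := lt_min hδ hδ₁
  refine ⟨16 / 3 * M ^ (1 / 4 : ℝ) * (Real.pi + Real.Gamma (5 / 4)), fun x hx =>
    ⟨min c δ₂, lt_min hc0 hδ₂, fun r hr hr₀ => ?_⟩⟩
  refine norm_hankelIntegral_half_le hc1 hδ₂ (by positivity) hx hr
    (hr₀.le.trans (min_le_left _ _)) (hr₀.trans_le (min_le_right _ _)) ?_ ?_ ?_
  · exact hcont.mono fun s hs => ⟨hs.1, hs.2.1, hs.2.2.trans_le (min_le_left _ _)⟩
  · intro s h1 h2 h3 h4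
    have h5 := hM s h1 (h2.trans_le (add_le_add_right (min_le_right _ _) _)) h3
      (h4.trans_le (min_le_right _ _))
    rw [← hFE s (by linarith) h3 (h4.trans_le (min_le_left _ _)), norm_pow] at h5
    rw [← Real.mul_rpow hM0 (norm_nonneg _)]
    have h6 := Real.rpow_le_rpow (by positivity) h5 (show (0 : ℝ) ≤ 1 / 4 by norm_num)
    have h7 := Real.pow_rpow_inv_natCast (norm_nonneg (F s)) (n := 4) (by norm_num)
    norm_num at h7 h6 ⊢
    rwa [h7] at h6
  · intro η hη σ h1 h2
    obtain ⟨w, hw⟩ := hE σ h1 h2.le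
    have hη0 : η ≠ 0 := by rintro rfl; simp at hη
    have hpath : Tendsto (fun ε : ℝ => (σ : ℂ) + (η * ε : ℝ) * I)
        (nhdsWithin 0 (Set.Ioi 0)) (nhds σ) := by
      have : ContinuousAt (fun ε : ℝ => (σ : ℂ) + (η * ε : ℝ) * I) 0 := by fun_prop
      simpa using this.tendsto.mono_left nhdsWithin_le_nhds
    have him : ∀ ε : ℝ, ((σ : ℂ) + (η * ε : ℝ) * I).im = η * ε := fun ε => by simp
    have hpath' : Tendsto (fun ε : ℝ => (σ : ℂ) + (η * ε : ℝ) * I)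
        (nhdsWithin 0 (Set.Ioi 0)) (nhdsWithin (σ : ℂ) {(σ : ℂ)}ᶜ) := by
      refine tendsto_nhdsWithin_iff.2 ⟨hpath, ?_⟩
      filter_upwards [self_mem_nhdsWithin] with ε hε h
      have h3 := him ε
      rw [Set.mem_singleton_iff.1 h, ofReal_im] at h3
      exact mul_ne_zero hη0 (ne_of_gt hε) h3.symm
    refine ⟨w * (σ - 1 / 2), ((hw.comp hpath').mul (hpath.sub_const _)).congr' ?_⟩
    filter_upwards [Ioo_mem_nhdsGT hδ] with ε hε
    have h3 : ((σ : ℂ) + (η * ε : ℝ) * I).im ≠ 0 := by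
      rw [him]
      exact mul_ne_zero hη0 hε.1.ne'
    have h4 : (σ : ℂ) + (η * ε : ℝ) * I - 1 / 2 ≠ 0 := by
      intro h
      apply h3
      rw [sub_eq_zero.1 h]
      norm_num
    rw [Function.comp_apply, div_mul_cancel₀ _ h4, hFE _ _ h3]
    · rw [him, abs_mul, hη, one_mul, abs_of_pos hε.1]
      exact hε.2
    · simp
      linarith

theorem LVal_eq_LFunction {N : ℕ} [NeZero N] (χ : DirichletCharacter ℂ N) (s : ℂ) :
    LVal χ s = DirichletCharacter.LFunction χ s :=
  dif_neg (NeZero.ne N)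

theorem ne_of_im_ne_zero {s : ℂ} (hs : s.im ≠ 0) (t : ℝ) : s ≠ t := by
  rintro rfl
  simp at hs

/-- The local factor at `2` does not vanish in the right half-plane. -/
theorem one_sub_apply_two_mul_cpow_ne_zero {q : ℕ} (χ : DirichletCharacter ℂ q) {s : ℂ}
    (hs : 0 < s.re) : 1 - χ 2 * (2 : ℂ) ^ (-s) ≠ 0 := by
  intro h
  have h1 := norm_mul_prime_cpow_lt_one χ Nat.prime_two hs
  push_cast at h1
  rw [← sub_eq_zero.1 h, norm_one] at h1
  exact lt_irrefl _ h1

theorem exists_forall_LFunction_half_add_ne_zero {N : ℕ} [NeZero N]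
    (χ : DirichletCharacter ℂ N) :
    ∃ δ : ℝ, 0 < δ ∧ ∀ t : ℝ, t ≠ 0 → |t| < δ →
      DirichletCharacter.LFunction χ (1 / 2 + t * I) ≠ 0 := by
  have hd : DifferentiableOn ℂ (DirichletCharacter.LFunction χ) {1}ᶜ := fun s hs =>
    (DirichletCharacter.differentiableAt_LFunction χ s (Or.inl hs)).differentiableWithinAt
  have hA := hd.analyticOnNhd isOpen_compl_singleton
  have hpre : IsPreconnected ({1}ᶜ : Set ℂ) :=
    (isConnected_compl_singleton_of_one_lt_rank (by simp [Complex.rank_real_complex]) 1).isPreconnected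
  have h12 : (1 / 2 : ℂ) ∈ ({1}ᶜ : Set ℂ) := by norm_num
  have hev : ∀ᶠ s in nhdsWithin (1 / 2 : ℂ) {1 / 2}ᶜ, DirichletCharacter.LFunction χ s ≠ 0 := by
    refine (hA _ h12).eventually_eq_zero_or_eventually_ne_zero.resolve_left fun h0 => ?_
    have := hA.eqOn_zero_of_preconnected_of_eventuallyEq_zero hpre h12 h0
      (show (2 : ℂ) ∈ ({1}ᶜ : Set ℂ) by norm_num)
    exact DirichletCharacter.LFunction_ne_zero_of_one_le_re χ (Or.inr (by norm_num))
      (by norm_num) this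
  obtain ⟨δ, hδ, hsub⟩ := Metric.eventually_nhds_iff.1 (eventually_nhdsWithin_iff.1 hev)
  refine ⟨δ, hδ, fun t ht htδ => hsub ?_ ?_⟩
  · simpa [Complex.dist_eq] using htδ
  · simpa using ht

/-- The identity expressing `F(s,χ)⁴` through Dirichlet `L`-functions continues analytically to
strips adjacent to the real axis in which `F` is holomorphic. -/
theorem pow_four_mul_LFunction_eq {q : ℕ} [NeZero q] {χ : DirichletCharacter ℂ q} (hχ : χ ≠ 1)
    {F : ℂ → ℂ} {δ : ℝ}
    (hFser : ∀ s : ℂ, 1 < s.re → F s = LSeries (STwist χ) s)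
    (hF : DifferentiableOn ℂ F {s | 1 / 4 < s.re ∧ s.im ≠ 0 ∧ |s.im| < δ})
    {s : ℂ} (hs : 1 / 4 < s.re) (hs0 : s.im ≠ 0) (hsδ : |s.im| < δ) :
    F s ^ 4 * DirichletCharacter.LFunction (mulChiNeg4 (χ ^ 2)) (2 * s) *
        (1 - χ 2 * 2 ^ (-s)) =
      DirichletCharacter.LFunction χ s ^ 2 * DirichletCharacter.LFunction (mulChiNeg4 χ) s ^ 2 *
        DirichletCharacter.LFunction (χ ^ 2) (2 * s) * quarticFactor χ (4 * s) *
        (1 + χ 2 * 2 ^ (-s)) := by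
  set U : Set ℂ := {z | 1 / 4 < z.re ∧ 0 < s.im * z.im ∧ |z.im| < δ} with hU
  have hUo : IsOpen U :=
    (isOpen_lt continuous_const continuous_re).inter
      ((isOpen_lt continuous_const (continuous_const.mul continuous_im)).inter
        (isOpen_lt continuous_im.abs continuous_const))
  have hUc : Convex ℝ U := by
    have h1 : Convex ℝ {z : ℂ | 1 / 4 < z.re} := convex_halfSpace_re_gt _
    have h2 : Convex ℝ {z : ℂ | 0 < s.im * z.im} :=
      convex_halfSpace_gt (f := fun z : ℂ => s.im * z.im)
        ⟨fun x y => by simp [mul_add], fun a x => by simp; ring⟩ 0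
    have h3 : Convex ℝ {z : ℂ | |z.im| < δ} := by
      have e : {z : ℂ | |z.im| < δ} = {z : ℂ | z.im < δ} ∩ {z : ℂ | -δ < z.im} := by
        ext z
        simp only [Set.mem_ofPred_eq, Set.mem_inter_iff, abs_lt, and_comm]
      rw [e]
      exact (convex_halfSpace_im_lt _).inter (convex_halfSpace_im_gt _)
    exact h1.inter (h2.inter h3)
  have him : ∀ z ∈ U, z.im ≠ 0 := fun z hz h => by
    have := hz.2.1
    rw [h, mul_zero] at this
    exact lt_irrefl _ this
  have h2 : ∀ z ∈ U, (2 : ℂ) * z ≠ 1 := fun z hz => by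
    have := ne_of_im_ne_zero (s := 2 * z) (by simpa using him z hz) 1
    simpa using this
  have h1 : ∀ z ∈ U, z ≠ 1 := fun z hz => by simpa using ne_of_im_ne_zero (him z hz) 1
  have hcp : Differentiable ℂ fun z : ℂ => χ 2 * (2 : ℂ) ^ (-z) :=
    (differentiable_neg.const_cpow (Or.inl two_ne_zero)).const_mul _
  have hd2 : ∀ {N : ℕ} [NeZero N] (ψ : DirichletCharacter ℂ N),
      DifferentiableOn ℂ (fun z => DirichletCharacter.LFunction ψ (2 * z)) U := fun ψ z hz =>
    (DifferentiableAt.comp z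
      (DirichletCharacter.differentiableAt_LFunction ψ _ (Or.inl (h2 z hz)))
      (differentiableAt_id.const_mul 2)).differentiableWithinAt
  have hd1 : ∀ {N : ℕ} [NeZero N] (ψ : DirichletCharacter ℂ N),
      DifferentiableOn ℂ (DirichletCharacter.LFunction ψ) U := fun ψ z hz =>
    (DirichletCharacter.differentiableAt_LFunction ψ _
      (Or.inl (h1 z hz))).differentiableWithinAt
  have hq4 : DifferentiableOn ℂ (fun z => quarticFactor χ (4 * z)) U := fun z hz =>
    (DifferentiableAt.comp z (differentiableAt_quarticFactor χ (by
      have := hz.1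
      simp
      linarith)) (differentiableAt_id.const_mul 4)).differentiableWithinAt
  have hFU : DifferentiableOn ℂ F U := hF.mono fun z hz => ⟨hz.1, him z hz, hz.2.2⟩
  have hleft := (((hFU.pow 4).mul (hd2 (mulChiNeg4 (χ ^ 2)))).mul
    (hcp.differentiableOn.const_sub 1)).analyticOnNhd hUo
  have hright := ((((((hd1 χ).pow 2).mul ((hd1 (mulChiNeg4 χ)).pow 2)).mul (hd2 (χ ^ 2))).mul
    hq4).mul (hcp.differentiableOn.const_add 1)).analyticOnNhd hUo
  have hsU : s ∈ U := ⟨hs, mul_self_pos.2 hs0, hsδ⟩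
  have hbase : (2 + s.im * I : ℂ) ∈ U := by
    refine ⟨?_, ?_, ?_⟩
    · simp
      norm_num
    · simpa using mul_self_pos.2 hs0
    · simpa using hsδ
  refine hleft.eqOn_of_preconnected_of_eventuallyEq hright hUc.isPreconnected hbase ?_ hsU
  have hopen : IsOpen {z : ℂ | 1 < z.re} := isOpen_lt continuous_const continuous_re
  filter_upwards [hopen.mem_nhds (show (1 : ℝ) < (2 + s.im * I : ℂ).re by simp)] with z hz
  have hz1 : 1 < z.re := hz
  have hz2 : 1 < (2 * z).re := by simp; linarith
  have := LSeries_STwist_pow_four hχ hz1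
  rw [← hFser z hz1, ← DirichletCharacter.LFunction_eq_LSeries _ hz2,
    ← DirichletCharacter.LFunction_eq_LSeries _ hz1,
    ← DirichletCharacter.LFunction_eq_LSeries _ hz1,
    ← DirichletCharacter.LFunction_eq_LSeries _ hz2] at this
  exact this

theorem tendsto_sub_half_mul_LFunction_one (N : ℕ) [NeZero N] :
    ∃ w : ℂ, w ≠ 0 ∧ Tendsto
      (fun s => (s - 1 / 2) * DirichletCharacter.LFunction (1 : DirichletCharacter ℂ N) (2 * s))
      (nhdsWithin (1 / 2) {1 / 2}ᶜ) (nhds w) := by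
  have h := DirichletCharacter.LFunctionTrivChar_residue_one (N := N)
  have hpath : Tendsto (fun s : ℂ => 2 * s) (nhdsWithin (1 / 2) {1 / 2}ᶜ)
      (nhdsWithin 1 {1}ᶜ) := by
    refine tendsto_nhdsWithin_iff.2 ⟨?_, ?_⟩
    · have : ContinuousAt (fun s : ℂ => 2 * s) (1 / 2) := by fun_prop
      have h2 := this.tendsto
      rw [show 2 * (1 / 2 : ℂ) = 1 by norm_num] at h2
      exact h2.mono_left nhdsWithin_le_nhds
    · filter_upwards [self_mem_nhdsWithin] with s hs h
      refine hs ?_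
      have h' : 2 * s = 1 := h
      exact Set.mem_singleton_iff.2 (by linear_combination h' / 2)
  refine ⟨(∏ p ∈ N.primeFactors, (1 - (p : ℂ)⁻¹)) / 2, div_ne_zero ?_ two_ne_zero,
    ((h.comp hpath).div_const 2).congr fun s => ?_⟩
  · refine Finset.prod_ne_zero_iff.2 fun p hp h0 => ?_
    have hp1 := (Nat.prime_of_mem_primeFactors hp).one_lt
    have : (p : ℂ) = 1 := by
      have := inv_eq_one.1 (sub_eq_zero.1 h0).symm
      exact this
    exact hp1.ne' (by exact_mod_cast this)
  · simp only [Function.comp_apply, DirichletCharacter.LFunctionTrivChar]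
    ring

/-- The function `F(s,χ)⁴`, written in terms of Dirichlet `L`-functions. -/
def quarticQuotient {q : ℕ} [NeZero q] (χ : DirichletCharacter ℂ q) (s : ℂ) : ℂ :=
  DirichletCharacter.LFunction χ s ^ 2 * DirichletCharacter.LFunction (mulChiNeg4 χ) s ^ 2 *
    DirichletCharacter.LFunction (χ ^ 2) (2 * s) * quarticFactor χ (4 * s) *
    (1 + χ 2 * 2 ^ (-s)) /
  (DirichletCharacter.LFunction (mulChiNeg4 (χ ^ 2)) (2 * s) * (1 - χ 2 * 2 ^ (-s)))

theorem LFunction_two_mul_ne_zero_of_GRH {N : ℕ} [NeZero N] {ψ : DirichletCharacter ℂ N}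
    (h : GRH ψ) {s : ℂ} (hs : 1 / 4 < s.re) (hs1 : ψ ≠ 1 ∨ 2 * s ≠ 1) :
    DirichletCharacter.LFunction ψ (2 * s) ≠ 0 := by
  intro h0
  have hre : (2 * s).re = 2 * s.re := by simp
  rcases lt_or_ge (2 * s).re 1 with h1 | h1
  · have := h (2 * s) (by linarith) h1 ((LVal_eq_LFunction ψ _).trans h0)
    linarith
  · exact DirichletCharacter.LFunction_ne_zero_of_one_le_re ψ hs1 h1 h0

theorem exists_tendsto_quarticQuotient_div {q : ℕ} [NeZero q] {χ : DirichletCharacter ℂ q}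
    (h4 : GRH (mulChiNeg4 (χ ^ 2)))
    (hcase : mulChiNeg4 (χ ^ 2) = 1 ∨ (χ ^ 2 = 1 ∧
      DirichletCharacter.LFunction χ (1 / 2) *
        DirichletCharacter.LFunction (mulChiNeg4 χ) (1 / 2) = 0))
    {σ : ℝ} (hσ : 1 / 4 < σ) (hσ1 : σ ≤ 1 / 2) :
    ∃ w, Tendsto (fun s => quarticQuotient χ s / (s - 1 / 2))
      (nhdsWithin (σ : ℂ) {(σ : ℂ)}ᶜ) (nhds w) := by
  have hq : 0 < q := Nat.pos_of_ne_zero (NeZero.ne q)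
  have hy : 1 - χ 2 * (2 : ℂ) ^ (-(σ : ℂ)) ≠ 0 :=
    one_sub_apply_two_mul_cpow_ne_zero χ (by rw [ofReal_re]; linarith)
  have hcp : ContinuousAt (fun z : ℂ => χ 2 * (2 : ℂ) ^ (-z)) σ :=
    (continuousAt_const.mul (continuousAt_id.neg.const_cpow (Or.inl two_ne_zero)))
  have hq4 : ContinuousAt (fun z : ℂ => quarticFactor χ (4 * z)) σ :=
    (DifferentiableAt.comp (σ : ℂ) (differentiableAt_quarticFactor χ (by
      simp
      linarith)) (differentiableAt_id.const_mul 4)).continuousAt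
  have hσne : (σ : ℂ) ≠ 1 := by
    have : σ ≠ 1 := by linarith
    exact_mod_cast this
  have hd1 : ∀ {N : ℕ} [NeZero N] (ψ : DirichletCharacter ℂ N),
      DifferentiableAt ℂ (DirichletCharacter.LFunction ψ) σ := fun ψ =>
    DirichletCharacter.differentiableAt_LFunction ψ _ (Or.inl hσne)
  have hd2 : ∀ {N : ℕ} [NeZero N] (ψ : DirichletCharacter ℂ N), 2 * (σ : ℂ) ≠ 1 ∨ ψ ≠ 1 →
      ContinuousAt (fun z => DirichletCharacter.LFunction ψ (2 * z)) σ := fun ψ h =>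
    (DifferentiableAt.comp (σ : ℂ) (DirichletCharacter.differentiableAt_LFunction ψ _ h)
      (differentiableAt_id.const_mul 2)).continuousAt
  rcases hσ1.lt_or_eq with hlt | heq
  · have h2 : 2 * (σ : ℂ) ≠ 1 := by
      have : 2 * σ ≠ 1 := by linarith
      exact_mod_cast this
    have h3 : (σ : ℂ) - 1 / 2 ≠ 0 := fun h => h2 (by linear_combination 2 * h)
    have h5 : DirichletCharacter.LFunction (mulChiNeg4 (χ ^ 2)) (2 * (σ : ℂ)) ≠ 0 :=
      LFunction_two_mul_ne_zero_of_GRH h4 (by rwa [ofReal_re]) (Or.inr h2)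
    have hc : ContinuousAt (fun s => quarticQuotient χ s / (s - 1 / 2)) (σ : ℂ) := by
      refine ContinuousAt.div (ContinuousAt.div ?_ ((hd2 _ (Or.inl h2)).mul
        (continuousAt_const.sub hcp)) (mul_ne_zero h5 hy)) (by fun_prop) h3
      exact (((((hd1 χ).continuousAt.pow 2).mul ((hd1 (mulChiNeg4 χ)).continuousAt.pow 2)).mul
        (hd2 _ (Or.inl h2))).mul hq4).mul (continuousAt_const.add hcp)
    exact ⟨_, hc.tendsto.mono_left nhdsWithin_le_nhds⟩
  · have hhalf : (σ : ℂ) = 1 / 2 := by rw [heq]; norm_num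
    clear hσne
    generalize (σ : ℂ) = z at hhalf hy hcp hq4 hd1 hd2 ⊢
    subst hhalf
    rcases hcase with hA | ⟨hB, hB0⟩
    · have hχ2 : χ ^ 2 ≠ 1 := fun h => mulChiNeg4_one_ne_one hq (h ▸ hA)
      obtain ⟨w, hw0, hw⟩ := tendsto_sub_half_mul_LFunction_one (4 * q)
      have hnum : ContinuousAt (fun s => DirichletCharacter.LFunction χ s ^ 2 *
          DirichletCharacter.LFunction (mulChiNeg4 χ) s ^ 2 *
          DirichletCharacter.LFunction (χ ^ 2) (2 * s) * quarticFactor χ (4 * s) *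
          (1 + χ 2 * 2 ^ (-s))) (1 / 2) :=
        (((((hd1 χ).continuousAt.pow 2).mul ((hd1 (mulChiNeg4 χ)).continuousAt.pow 2)).mul
          (hd2 _ (Or.inr hχ2))).mul hq4).mul (continuousAt_const.add hcp)
      have hfac : ContinuousAt (fun s : ℂ => 1 - χ 2 * (2 : ℂ) ^ (-s)) (1 / 2) :=
        continuousAt_const.sub hcp
      have hden := hw.mul (hfac.tendsto.mono_left (nhdsWithin_le_nhds (s := {1 / 2}ᶜ)))
      have hdiv := (hnum.tendsto.mono_left (nhdsWithin_le_nhds (s := {1 / 2}ᶜ))).div hden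
        (mul_ne_zero hw0 hy)
      refine ⟨_, hdiv.congr fun s => ?_⟩
      simp only [quarticQuotient, hA, Pi.div_apply]
      rw [div_div]
      congr 1
      ring
    · have hm : mulChiNeg4 (χ ^ 2) ≠ 1 := hB ▸ mulChiNeg4_one_ne_one hq
      have h5 : DirichletCharacter.LFunction (mulChiNeg4 (χ ^ 2)) (2 * (1 / 2)) ≠ 0 :=
        LFunction_two_mul_ne_zero_of_GRH h4 (by norm_num) (Or.inl hm)
      obtain ⟨w, -, hw⟩ := tendsto_sub_half_mul_LFunction_one q
      have hslope := ((hd1 χ).mul (hd1 (mulChiNeg4 χ))).hasDerivAt.tendsto_slope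
      have hrest : ContinuousAt (fun s => quarticFactor χ (4 * s) * (1 + χ 2 * 2 ^ (-s)) /
          (DirichletCharacter.LFunction (mulChiNeg4 (χ ^ 2)) (2 * s) *
            (1 - χ 2 * 2 ^ (-s)))) (1 / 2) :=
        (hq4.mul (continuousAt_const.add hcp)).div
          ((hd2 _ (Or.inr hm)).mul (continuousAt_const.sub hcp)) (mul_ne_zero h5 hy)
      have hprod := ((hslope.pow 2).mul hw).mul
        (hrest.tendsto.mono_left (nhdsWithin_le_nhds (s := {1 / 2}ᶜ)))
      refine ⟨_, hprod.congr' ?_⟩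
      filter_upwards [self_mem_nhdsWithin] with s hs
      have hs0 : s - 1 / 2 ≠ 0 := sub_ne_zero.2 hs
      simp only [slope_def_field, Pi.mul_apply, hB0, sub_zero, quarticQuotient, hB]
      field_simp

/-- **Lemma 4.4:** bound for the Hankel loop integral around `s = 1/2` in the degenerate
cases. -/
theorem hankel_half_bound
    (q : ℕ) (hq : 0 < q) (χ : DirichletCharacter ℂ q) (hχ : χ ≠ 1)
    (h1 : GRH χ) (h2 : GRH (mulChiNeg4 χ)) (h3 : GRH (χ ^ 2)) (h4 : GRH (mulChiNeg4 (χ ^ 2)))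
    (c : ℝ) (hc0 : 0 < c) (hc1 : c < 1 / 8)
    (F : ℂ → ℂ)
    (hFser : ∀ s : ℂ, 1 < s.re → F s = LSeries (STwist χ) s)
    (hFan : DifferentiableOn ℂ F {s : ℂ | 1 / 4 < s.re ∧ (s.re ≤ 1 / 2 →
      LVal χ (1 / 2 + s.im * I) * LVal (mulChiNeg4 χ) (1 / 2 + s.im * I) ≠ 0 ∧
      ¬(s.im = 0 ∧ (χ ^ 2 = 1 ∨ mulChiNeg4 (χ ^ 2) = 1)))})
    (hcase : mulChiNeg4 (χ ^ 2) = 1 ∨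
      (χ ^ 2 = 1 ∧ LVal χ (1 / 2) * LVal (mulChiNeg4 χ) (1 / 2) = 0)) :
    ∃ C : ℝ, ∀ x : ℝ, 2 ≤ x → ∃ r₀ : ℝ, 0 < r₀ ∧ ∀ r : ℝ, 0 < r → r < r₀ →
      ‖hankelIntegral (fun s => F s * (x : ℂ) ^ s / s) (1 / 2) c r‖
        ≤ C * Real.sqrt x * (x ^ r * r ^ ((5 : ℝ) / 4) + Real.log x ^ (-(5 : ℝ) / 4)) := by
  have : NeZero q := ⟨hq.ne'⟩
  obtain ⟨δ₁, hδ₁, hL₁⟩ := exists_forall_LFunction_half_add_ne_zero χ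
  obtain ⟨δ₂, hδ₂, hL₂⟩ := exists_forall_LFunction_half_add_ne_zero (mulChiNeg4 χ)
  have hF : DifferentiableOn ℂ F {s | 1 / 4 < s.re ∧ s.im ≠ 0 ∧ |s.im| < min δ₁ δ₂} := by
    refine hFan.mono fun s hs => ⟨hs.1, fun _ => ⟨?_, fun h => hs.2.1 h.1⟩⟩
    rw [LVal_eq_LFunction, LVal_eq_LFunction]
    exact mul_ne_zero (hL₁ _ hs.2.1 (hs.2.2.trans_le (min_le_left _ _)))
      (hL₂ _ hs.2.1 (hs.2.2.trans_le (min_le_right _ _)))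
  simp only [LVal_eq_LFunction] at hcase
  refine exists_norm_hankelIntegral_half_le (E := quarticQuotient χ) hc0 hc1
    (lt_min hδ₁ hδ₂) (hF.continuousOn.mono fun s hs => ⟨by linarith [hs.1], hs.2⟩) ?_ ?_
  · intro s hs hs0 hsδ
    have h2 : 2 * s ≠ 1 := by
      have := ne_of_im_ne_zero (s := 2 * s) (by simpa using hs0) 1
      simpa using this
    rw [quarticQuotient, eq_div_iff (mul_ne_zero
      (LFunction_two_mul_ne_zero_of_GRH h4 (by linarith) (Or.inr h2))
      (one_sub_apply_two_mul_cpow_ne_zero χ (by linarith))), ← mul_assoc]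
    exact pow_four_mul_LFunction_eq hχ hFser hF (by linarith) hs0 hsδ
  · exact fun σ h5 h6 => exists_tendsto_quarticQuotient_div h4 hcase (by linarith) h6

end
end

section
/- Fix c ∈ (0,1/8). Then (1/2πi) ∫_{H_{1/2}} (s − 1/2)^{−1/4} x^s ds = (1/Γ(1/4)) · √x/(log x)^{3/4} · (1 + O(x^{−c/2})) as x → ∞, where H_{1/2} is a truncated Hankel loop around 1/2 of radius r = o(1/log x), and (s − 1/2)^{−1/4} = exp(−(1/4) log(s − 1/2)) with −π < arg(s − 1/2) ≤ π on the contour. -/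
open Complex Filter
open scoped Classical

noncomputable section

/-- Power series expansion of the lower incomplete Gamma integral. -/
theorem hasSum_integral_rpow_mul_exp {a r : ℝ} (L : ℝ) (ha : a < 1) (hr : 0 < r) :
    HasSum (fun n : ℕ => (-L) ^ n / n.factorial * (r ^ (n + 1 - a) / (n + 1 - a)))
      (∫ t in (0 : ℝ)..r, t ^ (-a) * Real.exp (-(L * t))) := by
  have hint : ∀ n : ℕ, ∫ t in (0 : ℝ)..r, t ^ (-a) * ((-(L * t)) ^ n / n.factorial)
      = (-L) ^ n / n.factorial * (r ^ (n + 1 - a) / (n + 1 - a)) := by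
    intro n
    have hn : (0 : ℝ) ≤ n := n.cast_nonneg
    have h1 : ∫ t in (0 : ℝ)..r, t ^ (-a) * ((-(L * t)) ^ n / n.factorial)
        = ∫ t in (0 : ℝ)..r, (-L) ^ n / n.factorial * t ^ (n - a) := by
      refine intervalIntegral.integral_congr_ae (Eventually.of_forall fun t ht => ?_)
      rw [Set.uIoc_of_le hr.le] at ht
      have h2 : t ^ ((n : ℝ) - a) = t ^ n * t ^ (-a) := by
        rw [sub_eq_add_neg, Real.rpow_add ht.1, Real.rpow_natCast]
      rw [h2, ← neg_mul, mul_pow]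
      ring
    rw [h1, intervalIntegral.integral_const_mul, integral_rpow (Or.inl (by linarith)),
      Real.zero_rpow (by linarith), sub_zero, show (n : ℝ) - a + 1 = n + 1 - a by ring]
  simp_rw [← hint]
  have hsum : ∀ t : ℝ, HasSum (fun n : ℕ => t ^ (-a) * ((|L| * r) ^ n / n.factorial))
      (t ^ (-a) * Real.exp (|L| * r)) := fun t => by
    have := NormedSpace.expSeries_div_hasSum_exp (|L| * r)
    rw [← Real.exp_eq_exp_ℝ] at this
    exact this.mul_left _
  refine intervalIntegral.hasSum_integral_of_dominated_convergence
    (fun n t => t ^ (-a) * ((|L| * r) ^ n / n.factorial)) (fun n => ?_) (fun n => ?_) ?_ ?_ ?_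
  · exact Measurable.aestronglyMeasurable (by fun_prop)
  · refine Eventually.of_forall fun t ht => ?_
    rw [Set.uIoc_of_le hr.le] at ht
    rw [norm_mul, norm_div, norm_pow, norm_neg, norm_mul, Real.norm_of_nonneg
      (Real.rpow_nonneg ht.1.le _), Real.norm_natCast, Real.norm_eq_abs, Real.norm_eq_abs t,
      abs_of_pos ht.1]
    have := ht.1.le
    have := ht.2
    gcongr
  · exact Eventually.of_forall fun t _ => (hsum t).summable
  · simp_rw [fun t => (hsum t).tsum_eq]
    exact (intervalIntegral.intervalIntegrable_rpow' (by linarith)).mul_const _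
  · refine Eventually.of_forall fun t _ => ?_
    have := NormedSpace.expSeries_div_hasSum_exp (-(L * t))
    rw [← Real.exp_eq_exp_ℝ] at this
    exact this.mul_left _

theorem ofReal_mul_exp_cpow {r θ : ℝ} (b : ℝ) (hr : 0 < r)
    (hθ : θ ∈ Set.Ioc (-Real.pi) Real.pi) :
    ((r : ℂ) * exp (θ * I)) ^ (b : ℂ) = (r ^ b : ℝ) * exp (b * θ * I) := by
  have hr' : (r : ℂ) ≠ 0 := by exact_mod_cast hr.ne'
  rw [cpow_def_of_ne_zero (mul_ne_zero hr' (exp_ne_zero _)), log_ofReal_mul hr (exp_ne_zero _),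
    log_exp (by simpa using hθ.1) (by simpa using hθ.2), ofReal_cpow hr.le,
    cpow_def_of_ne_zero hr', ← exp_add, ofReal_log hr.le]
  ring_nf

/-- The integral of `z ^ (-a) * exp (L * z)` over a circle cut along the negative axis, expressed
as the jump integral over the enclosed part of the cut. -/
theorem integral_circle_cpow_mul_exp {a r : ℝ} (L : ℝ) (ha : a < 1) (hr : 0 < r) :
    ∫ θ in (-Real.pi)..Real.pi, ((r : ℂ) * exp (θ * I)) ^ ((-a : ℝ) : ℂ)
        * exp (L * (r * exp (θ * I))) * (I * r * exp (θ * I))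
      = 2 * I * Real.sin (Real.pi * a)
        * ((∫ t in (0 : ℝ)..r, t ^ (-a) * Real.exp (-(L * t)) : ℝ) : ℂ) := by
  have hpi := Real.pi_pos
  set F : ℕ → ℝ → ℂ := fun n θ => (I * (r ^ (1 - a) : ℝ) * exp ((1 - a) * θ * I))
    * ((L * (r * exp (θ * I))) ^ n / n.factorial) with hF
  have hFint : ∀ n : ℕ, ∫ θ in (-Real.pi)..Real.pi, F n θ = 2 * I * Real.sin (Real.pi * a)
      * (((-L) ^ n / n.factorial * (r ^ (n + 1 - a) / (n + 1 - a)) : ℝ) : ℂ) := by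
    intro n
    have hn : (0 : ℝ) < n + 1 - a := by
      have : (0 : ℝ) ≤ n := n.cast_nonneg
      linarith
    have hn' : ((n : ℂ) + 1 - a) ≠ 0 := by exact_mod_cast hn.ne'
    have h1 : ∀ θ : ℝ, F n θ = (I * (r ^ (n + 1 - a) : ℝ) * L ^ n / n.factorial)
        * exp ((I * (n + 1 - a)) * θ) := by
      intro θ
      have h2 : r ^ ((n : ℝ) + 1 - a) = r ^ n * r ^ (1 - a) := by
        rw [add_sub_assoc, Real.rpow_add hr, Real.rpow_natCast]
      have h3 : exp ((I * (n + 1 - a)) * θ) = exp (θ * I) ^ n * exp ((1 - a) * θ * I) := by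
        rw [← exp_nat_mul, ← exp_add]
        ring_nf
      rw [hF, h2, h3]
      push_cast
      ring
    have h4 : exp (I * (n + 1 - a) * Real.pi) - exp (I * (n + 1 - a) * (-Real.pi : ℝ))
        = 2 * I * ((-1) ^ n * Real.sin (Real.pi * a)) := by
      have h5 : Real.sin ((n + 1 - a) * Real.pi) = (-1) ^ n * Real.sin (Real.pi * a) := by
        rw [show (n + 1 - a) * Real.pi = (Real.pi - Real.pi * a) + n * Real.pi by ring,
          Real.sin_add_nat_mul_pi, Real.sin_pi_sub]
      have h6 : (Real.sin ((n + 1 - a) * Real.pi) : ℂ) = (-1) ^ n * Real.sin (Real.pi * a) := by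
        rw [h5]; push_cast; ring
      rw [← h6, ofReal_sin, Complex.sin]
      push_cast
      ring_nf
      simp only [I_sq]
      ring_nf
    simp_rw [h1]
    rw [intervalIntegral.integral_const_mul, integral_exp_mul_complex (mul_ne_zero I_ne_zero hn'),
      h4]
    push_cast
    rw [neg_pow (L : ℂ)]
    field_simp [I_ne_zero]
  have key : HasSum (fun n => ∫ θ in (-Real.pi)..Real.pi, F n θ)
      (∫ θ in (-Real.pi)..Real.pi, ((r : ℂ) * exp (θ * I)) ^ ((-a : ℝ) : ℂ)
        * exp (L * (r * exp (θ * I))) * (I * r * exp (θ * I))) := by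
    have hsum : HasSum (fun n : ℕ => r ^ (1 - a) * ((|L| * r) ^ n / n.factorial))
        (r ^ (1 - a) * Real.exp (|L| * r)) := by
      have := NormedSpace.expSeries_div_hasSum_exp (|L| * r)
      rw [← Real.exp_eq_exp_ℝ] at this
      exact this.mul_left _
    refine intervalIntegral.hasSum_integral_of_dominated_convergence
      (fun n _ => r ^ (1 - a) * ((|L| * r) ^ n / n.factorial)) (fun n => ?_) (fun n => ?_) ?_ ?_ ?_
    · exact Continuous.aestronglyMeasurable (by fun_prop)
    · refine Eventually.of_forall fun θ _ => le_of_eq ?_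
      have e1 : ‖exp ((1 - a) * θ * I)‖ = 1 := by
        exact_mod_cast norm_exp_ofReal_mul_I ((1 - a) * θ)
      simp [hF, e1, norm_exp_ofReal_mul_I, abs_of_pos hr, abs_of_pos (Real.rpow_pos_of_pos hr _)]
    · exact Eventually.of_forall fun θ _ => hsum.summable
    · exact intervalIntegrable_const
    · refine Eventually.of_forall fun θ hθ => ?_
      rw [Set.uIoc_of_le (by linarith)] at hθ
      have := NormedSpace.expSeries_div_hasSum_exp ((L : ℂ) * (r * exp (θ * I)))
      rw [← Complex.exp_eq_exp_ℂ] at this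
      have h7 : exp ((1 - a) * θ * I) = exp ((-a : ℝ) * θ * I) * exp (θ * I) := by
        rw [← exp_add]
        push_cast
        ring_nf
      have h8 : r ^ (1 - a) = r ^ (-a) * r := by
        rw [sub_eq_neg_add, Real.rpow_add hr, Real.rpow_one]
      have h9 : ((r : ℂ) * exp (θ * I)) ^ ((-a : ℝ) : ℂ) * exp (L * (r * exp (θ * I)))
          * (I * r * exp (θ * I)) = I * (r ^ (1 - a) : ℝ) * exp ((1 - a) * θ * I)
            * exp (L * (r * exp (θ * I))) := by
        rw [ofReal_mul_exp_cpow _ hr hθ, h7, h8]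
        push_cast
        ring
      rw [h9]
      exact this.mul_left (I * (r ^ (1 - a) : ℝ) * exp ((1 - a) * θ * I))
  simp_rw [hFint] at key
  exact key.unique ((hasSum_ofReal.mpr (hasSum_integral_rpow_mul_exp L ha hr)).mul_left _)

/-- Boundary values of `z ^ (-a)` on the lower side of the negative axis. -/
theorem tendsto_cpow_below {t : ℝ} (a : ℝ) (ht : 0 < t) :
    Tendsto (fun ε : ℝ => (-(t : ℂ) + (-1 : ℝ) * ε * I) ^ ((-a : ℝ) : ℂ))
      (nhdsWithin 0 (Set.Ioi 0)) (nhds ((t ^ (-a) : ℝ) * exp (Real.pi * a * I))) := by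
  have ht' : (t : ℂ) ≠ 0 := by exact_mod_cast ht.ne'
  have hre : (-(t : ℂ)).re < 0 := by simpa using ht
  have hlog := tendsto_log_nhdsWithin_im_neg_of_re_neg_of_im_zero hre (by simp)
  have hpt : Tendsto (fun ε : ℝ => -(t : ℂ) + (-1 : ℝ) * ε * I) (nhdsWithin 0 (Set.Ioi 0))
      (nhdsWithin (-(t : ℂ)) {z | z.im < 0}) := by
    refine tendsto_nhdsWithin_iff.mpr ⟨?_, ?_⟩
    · exact (Continuous.tendsto' (by fun_prop) _ _ (by simp)).mono_left nhdsWithin_le_nhds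
    · filter_upwards [self_mem_nhdsWithin] with ε hε
      simpa using hε
  have h := (continuous_exp.tendsto _).comp ((hlog.comp hpt).mul_const ((-a : ℝ) : ℂ))
  have hlim : exp (((Real.log ‖-(t : ℂ)‖ : ℝ) - Real.pi * I) * ((-a : ℝ) : ℂ))
      = (t ^ (-a) : ℝ) * exp (Real.pi * a * I) := by
    rw [ofReal_cpow ht.le, cpow_def_of_ne_zero ht', ← exp_add, norm_neg,
      norm_real, Real.norm_of_nonneg ht.le, ofReal_log ht.le]
    push_cast
    ring_nf
  rw [hlim] at h
  refine h.congr fun ε => ?_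
  rw [cpow_def_of_ne_zero]
  · rfl
  · exact fun h0 => ht.ne' (by simpa using congrArg re h0)

/-- Boundary values of `z ^ (-a)` on the upper side of the negative axis. -/
theorem tendsto_cpow_above {t : ℝ} (a : ℝ) (ht : 0 < t) :
    Tendsto (fun ε : ℝ => (-(t : ℂ) + (1 : ℝ) * ε * I) ^ ((-a : ℝ) : ℂ))
      (nhdsWithin 0 (Set.Ioi 0)) (nhds ((t ^ (-a) : ℝ) * exp (-(Real.pi * a * I)))) := by
  have ht' : (t : ℂ) ≠ 0 := by exact_mod_cast ht.ne'
  have hre : (-(t : ℂ)).re < 0 := by simpa using ht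
  have hlog := (continuousWithinAt_log_of_re_neg_of_im_zero hre (by simp)).tendsto
  have hpt : Tendsto (fun ε : ℝ => -(t : ℂ) + (1 : ℝ) * ε * I) (nhdsWithin 0 (Set.Ioi 0))
      (nhdsWithin (-(t : ℂ)) {z | 0 ≤ z.im}) := by
    refine tendsto_nhdsWithin_iff.mpr ⟨?_, ?_⟩
    · exact (Continuous.tendsto' (by fun_prop) _ _ (by simp)).mono_left nhdsWithin_le_nhds
    · filter_upwards [self_mem_nhdsWithin] with ε hε
      simpa using le_of_lt hε
  have h := (continuous_exp.tendsto _).comp ((hlog.comp hpt).mul_const ((-a : ℝ) : ℂ))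
  have hlim : exp (log (-(t : ℂ)) * ((-a : ℝ) : ℂ))
      = (t ^ (-a) : ℝ) * exp (-(Real.pi * a * I)) := by
    have harg : arg (-(t : ℂ)) = Real.pi := by
      rw [← ofReal_neg]
      exact arg_ofReal_of_neg (by linarith)
    rw [ofReal_cpow ht.le, cpow_def_of_ne_zero ht', ← exp_add, log, harg, norm_neg,
      norm_real, Real.norm_of_nonneg ht.le, ofReal_log ht.le]
    push_cast
    ring_nf
  rw [hlim] at h
  refine h.congr fun ε => ?_
  rw [cpow_def_of_ne_zero]
  · rfl
  · exact fun h0 => ht.ne' (by simpa using congrArg re h0)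

/-- Limit of the integral over a horizontal segment approaching the cut, given the boundary values
of `z ^ (-a)` up to the phase `w`. -/
theorem tendsto_integral_segment {a c r x η : ℝ} {w : ℂ} (ρ : ℝ) (ha : 0 ≤ a) (hr : 0 < r)
    (hrc : r ≤ c) (hx : 0 < x)
    (hw : ∀ t : ℝ, 0 < t → Tendsto (fun ε : ℝ => (-(t : ℂ) + η * ε * I) ^ ((-a : ℝ) : ℂ))
      (nhdsWithin 0 (Set.Ioi 0)) (nhds ((t ^ (-a) : ℝ) * w))) :
    Tendsto (fun ε : ℝ => ∫ σ in (ρ - c)..(ρ - r),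
        ((σ : ℂ) + η * ε * I - ρ) ^ ((-a : ℝ) : ℂ) * (x : ℂ) ^ ((σ : ℂ) + η * ε * I))
      (nhdsWithin 0 (Set.Ioi 0))
      (nhds (w * (x ^ ρ : ℝ)
        * ((∫ t in r..c, t ^ (-a) * Real.exp (-(Real.log x * t)) : ℝ) : ℂ))) := by
  have hx' : (x : ℂ) ≠ 0 := by exact_mod_cast hx.ne'
  have hsub : ∀ ε : ℝ, ∫ σ in (ρ - c)..(ρ - r),
        ((σ : ℂ) + η * ε * I - ρ) ^ ((-a : ℝ) : ℂ) * (x : ℂ) ^ ((σ : ℂ) + η * ε * I)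
      = ∫ t in r..c, (-(t : ℂ) + η * ε * I) ^ ((-a : ℝ) : ℂ)
        * (x : ℂ) ^ ((ρ : ℂ) - t + η * ε * I) := fun ε => by
    rw [← intervalIntegral.integral_comp_sub_left]
    refine intervalIntegral.integral_congr fun t _ => ?_
    simp only [ofReal_sub]
    ring_nf
  have hlim : w * (x ^ ρ : ℝ) * ((∫ t in r..c, t ^ (-a) * Real.exp (-(Real.log x * t)) : ℝ) : ℂ)
      = ∫ t in r..c, ((t ^ (-a) : ℝ) : ℂ) * w * (x : ℂ) ^ ((ρ : ℂ) - t) := by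
    rw [← intervalIntegral.integral_ofReal, ← intervalIntegral.integral_const_mul]
    refine intervalIntegral.integral_congr fun t _ => ?_
    have : (x : ℂ) ^ ((ρ : ℂ) - t) = ((x ^ ρ * Real.exp (-(Real.log x * t)) : ℝ) : ℂ) := by
      rw [← ofReal_sub, ← ofReal_cpow hx.le, Real.rpow_def_of_pos hx, Real.rpow_def_of_pos hx,
        ← Real.exp_add]
      ring_nf
    simp only [this]
    push_cast
    ring
  simp_rw [hsub]
  rw [hlim]
  refine intervalIntegral.tendsto_integral_filter_of_dominated_convergence
    (fun t => t ^ (-a) * x ^ (ρ - t)) ?_ ?_ ?_ ?_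
  · exact Eventually.of_forall fun ε => Measurable.aestronglyMeasurable (by fun_prop)
  · refine Eventually.of_forall fun ε => Eventually.of_forall fun t ht => ?_
    rw [Set.uIoc_of_le hrc] at ht
    have ht0 : 0 < t := hr.trans ht.1
    rw [norm_mul, norm_cpow_real, norm_cpow_eq_rpow_re_of_pos hx]
    have hre : ((ρ : ℂ) - t + η * ε * I).re = ρ - t := by simp
    have hle : t ≤ ‖-(t : ℂ) + η * ε * I‖ := by
      have := abs_re_le_norm (-(t : ℂ) + η * ε * I)
      simpa [abs_of_pos ht0] using this
    rw [hre]
    exact mul_le_mul_of_nonneg_right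
      (Real.rpow_le_rpow_of_nonpos ht0 hle (by linarith)) (Real.rpow_nonneg hx.le _)
  · refine ContinuousOn.intervalIntegrable fun t ht => ContinuousAt.continuousWithinAt ?_
    rw [Set.uIcc_of_le hrc] at ht
    have ht0 : 0 < t := hr.trans_le ht.1
    exact (Real.continuousAt_rpow_const _ _ (Or.inl ht0.ne')).mul
      (ContinuousAt.rpow continuousAt_const (by fun_prop) (Or.inl hx.ne'))
  · refine Eventually.of_forall fun t ht => ?_
    rw [Set.uIoc_of_le hrc] at ht
    refine (hw t (hr.trans ht.1)).mul ?_
    refine Tendsto.mono_left ?_ nhdsWithin_le_nhds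
    have : Continuous fun ε : ℝ => (x : ℂ) ^ ((ρ : ℂ) - t + η * ε * I) :=
      Continuous.const_cpow (by fun_prop) (Or.inl hx')
    exact this.tendsto' _ _ (by simp)

/-- The truncated Hankel integral of `(s - ρ) ^ (-a) * x ^ s` does not depend on the radius. -/
theorem hankelIntegral_cpow_mul_cpow {a c r x : ℝ} (ρ : ℝ) (ha0 : 0 ≤ a) (ha : a < 1) (hr : 0 < r)
    (hrc : r ≤ c) (hx : 0 < x) :
    hankelIntegral (fun s => (s - ρ) ^ ((-a : ℝ) : ℂ) * (x : ℂ) ^ s) ρ c r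
      = 2 * I * Real.sin (Real.pi * a) * (x ^ ρ : ℝ)
        * ((∫ t in (0 : ℝ)..c, t ^ (-a) * Real.exp (-(Real.log x * t)) : ℝ) : ℂ) := by
  have hx' : (x : ℂ) ≠ 0 := by exact_mod_cast hx.ne'
  have hbelow := tendsto_integral_segment ρ ha0 hr hrc hx fun t ht => tendsto_cpow_below a ht
  have habove := tendsto_integral_segment ρ ha0 hr hrc hx fun t ht => tendsto_cpow_above a ht
  have hcirc : ∫ θ in (-Real.pi)..Real.pi,
        ((ρ : ℂ) + r * exp (θ * I) - ρ) ^ ((-a : ℝ) : ℂ) * (x : ℂ) ^ ((ρ : ℂ) + r * exp (θ * I))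
          * (I * r * exp (θ * I))
      = (x ^ ρ : ℝ) * (2 * I * Real.sin (Real.pi * a)
        * ((∫ t in (0 : ℝ)..r, t ^ (-a) * Real.exp (-(Real.log x * t)) : ℝ) : ℂ)) := by
    rw [← integral_circle_cpow_mul_exp _ ha hr, ← intervalIntegral.integral_const_mul]
    refine intervalIntegral.integral_congr fun θ _ => ?_
    simp only [add_sub_cancel_left]
    rw [cpow_add _ _ hx', ofReal_cpow hx.le, cpow_def_of_ne_zero hx' (r * exp (θ * I)),
      ofReal_log hx.le]
    ring
  have hint : ∀ u v : ℝ, IntervalIntegrable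
      (fun t : ℝ => t ^ (-a) * Real.exp (-(Real.log x * t))) MeasureTheory.volume u v := fun u v =>
    (intervalIntegral.intervalIntegrable_rpow' (by linarith)).mul_continuousOn
      (Continuous.continuousOn (by fun_prop))
  have hsin : exp (Real.pi * a * I) - exp (-(Real.pi * a * I))
      = 2 * I * Real.sin (Real.pi * a) := by
    rw [ofReal_sin, Complex.sin]
    push_cast
    ring_nf
    simp only [I_sq]
    ring_nf
  unfold hankelIntegral
  refine Tendsto.limUnder_eq ?_
  have h := (hbelow.add_const (∫ θ in (-Real.pi)..Real.pi,
        ((ρ : ℂ) + r * exp (θ * I) - ρ) ^ ((-a : ℝ) : ℂ) * (x : ℂ) ^ ((ρ : ℂ) + r * exp (θ * I))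
          * (I * r * exp (θ * I)))).sub habove
  convert h using 2
  · simp only [ofReal_re, ofReal_im, ofReal_zero, zero_sub, zero_add, ofReal_neg, ofReal_one,
      neg_mul, one_mul]
  · rw [hcirc, ← intervalIntegral.integral_add_adjacent_intervals (hint 0 r) (hint r c), ofReal_add]
    linear_combination (-(x ^ ρ : ℝ)
      * ((∫ t in r..c, t ^ (-a) * Real.exp (-(Real.log x * t)) : ℝ) : ℂ)) * hsin

open MeasureTheory in
/-- The truncated Gamma integral differs from the complete one by an exponentially small amount. -/
theorem abs_integral_rpow_mul_exp_sub_le {a c L : ℝ} (ha0 : 0 ≤ a) (ha : a < 1) (hc : 0 < c)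
    (hL : 0 < L) :
    |(∫ t in (0 : ℝ)..c, t ^ (-a) * Real.exp (-(L * t))) - L ^ (a - 1) * Real.Gamma (1 - a)|
      ≤ c ^ (-a) * (Real.exp (-(L * c)) / L) := by
  have hint0 : IntegrableOn (fun t : ℝ => t ^ (-a) * Real.exp (-(L * t))) (Set.Ioi 0) := by
    simpa using integrableOn_rpow_mul_exp_neg_mul_rpow (p := 1) (s := -a) (by linarith)
      one_pos hL
  have hintc := hint0.mono_set (Set.Ioi_subset_Ioi hc.le)
  have hexp : IntegrableOn (fun t : ℝ => Real.exp (-(L * t))) (Set.Ioi c) := by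
    simpa using integrableOn_exp_mul_Ioi (a := -L) (by linarith) c
  have hgamma : ∫ t in Set.Ioi (0 : ℝ), t ^ (-a) * Real.exp (-(L * t))
      = L ^ (a - 1) * Real.Gamma (1 - a) := by
    have := Real.integral_rpow_mul_exp_neg_mul_Ioi (a := 1 - a) (by linarith) hL
    rwa [one_div, Real.inv_rpow hL.le, ← Real.rpow_neg hL.le, neg_sub,
      show 1 - a - 1 = -a by ring] at this
  have hsplit := intervalIntegral.integral_interval_add_Ioi hint0 hintc
  have hnonneg : 0 ≤ ∫ t in Set.Ioi c, t ^ (-a) * Real.exp (-(L * t)) :=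
    setIntegral_nonneg measurableSet_Ioi fun t ht =>
      mul_nonneg (Real.rpow_nonneg (hc.le.trans (le_of_lt ht)) _) (Real.exp_pos _).le
  have hle : ∫ t in Set.Ioi c, t ^ (-a) * Real.exp (-(L * t))
      ≤ ∫ t in Set.Ioi c, c ^ (-a) * Real.exp (-(L * t)) :=
    setIntegral_mono_on hintc (hexp.const_mul _) measurableSet_Ioi fun t ht =>
      mul_le_mul_of_nonneg_right
        (Real.rpow_le_rpow_of_nonpos hc (le_of_lt ht) (by linarith)) (Real.exp_pos _).le
  have hval : ∫ t in Set.Ioi c, Real.exp (-(L * t)) = Real.exp (-(L * c)) / L := by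
    have := integral_exp_mul_Ioi (a := -L) (by linarith) c
    simp only [neg_mul, neg_div_neg_eq] at this
    exact this
  rw [integral_const_mul, hval] at hle
  rw [← hgamma, ← hsplit, sub_add_cancel_left, abs_neg, abs_of_nonneg hnonneg]
  exact hle

/-- **Hankel's formula:** the Hankel loop integral of `(s - 1/2)^{-1/4} x^s` around
`s = 1/2`, with radius `r = o(1/log x)`. -/
theorem hankel_quarter_root_asymptotic
    (c : ℝ) (hc0 : 0 < c) (hc1 : c < 1 / 8)
    (rf : ℝ → ℝ) (hrpos : ∀ᶠ x in atTop, 0 < rf x)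
    (hro : rf =o[atTop] fun x : ℝ => 1 / Real.log x) :
    ∃ C : ℝ, ∀ᶠ x : ℝ in atTop,
      ‖(1 / (2 * Real.pi * I)) *
          hankelIntegral (fun s => (s - 1 / 2) ^ (-(1 / 4) : ℂ) * (x : ℂ) ^ s) (1 / 2) c (rf x)
        - ((1 / Real.Gamma (1 / 4) * (Real.sqrt x / Real.log x ^ ((3 : ℝ) / 4)) : ℝ) : ℂ)‖
      ≤ C * (Real.sqrt x / Real.log x ^ ((3 : ℝ) / 4)) * x ^ (-c / 2) := by
  refine ⟨c ^ (-(1 / 4) : ℝ), ?_⟩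
  have hsmall : ∀ᶠ x in atTop, rf x ≤ c := by
    have h0 : Tendsto (fun x : ℝ => 1 / Real.log x) atTop (nhds 0) := by
      simp only [one_div]
      exact Real.tendsto_log_atTop.inv_tendsto_atTop
    exact (hro.trans_tendsto h0).eventually_le_const hc0
  filter_upwards [hrpos, hsmall, eventually_gt_atTop 0,
    Real.tendsto_log_atTop.eventually_ge_atTop 1] with x hr hrc hx hL
  have hL0 : 0 < Real.log x := by linarith
  have hH := hankelIntegral_cpow_mul_cpow (a := 1 / 4) (1 / 2) (by norm_num) (by norm_num) hr hrc hx
  have hT := abs_integral_rpow_mul_exp_sub_le (a := 1 / 4) (by norm_num) (by norm_num) hc0 hL0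
  push_cast at hH
  rw [hH]
  set J := ∫ t in (0 : ℝ)..c, t ^ (-(1 / 4) : ℝ) * Real.exp (-(Real.log x * t)) with hJ
  set S := Real.sin (Real.pi * (1 / 4)) with hS
  have hpi := Real.pi_pos
  have hS0 : 0 < S := Real.sin_pos_of_pos_of_lt_pi (by positivity) (by linarith)
  have hrefl : 1 / Real.Gamma (1 / 4) = S / Real.pi * Real.Gamma (1 - 1 / 4) := by
    have h := Real.Gamma_mul_Gamma_one_sub (1 / 4)
    have hG : 0 < Real.Gamma (1 / 4) := Real.Gamma_pos_of_pos (by norm_num)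
    rw [← hS] at h
    field_simp at h ⊢
    linarith
  have hLpow : 1 / Real.log x ^ ((3 : ℝ) / 4) = Real.log x ^ ((1 : ℝ) / 4 - 1) := by
    rw [one_div, ← Real.rpow_neg hL0.le]
    norm_num
  have heq : 1 / (2 * Real.pi * I) * (2 * I * S * (x ^ (1 / 2 : ℝ) : ℝ) * J)
      - ((1 / Real.Gamma (1 / 4) * (Real.sqrt x / Real.log x ^ ((3 : ℝ) / 4)) : ℝ) : ℂ)
      = ((S / Real.pi * Real.sqrt x
        * (J - Real.log x ^ ((1 : ℝ) / 4 - 1) * Real.Gamma (1 - 1 / 4)) : ℝ) : ℂ) := by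
    have hpi' : (Real.pi : ℂ) ≠ 0 := by exact_mod_cast hpi.ne'
    rw [hrefl, ← Real.sqrt_eq_rpow, ← hLpow]
    push_cast
    field_simp [I_ne_zero]
  have hx2 : Real.exp (-(Real.log x * c)) ≤ x ^ (-c / 2) := by
    rw [Real.rpow_def_of_pos hx]
    exact Real.exp_le_exp.mpr (by nlinarith)
  have hLle : 1 / Real.log x ≤ 1 / Real.log x ^ ((3 : ℝ) / 4) := by
    refine one_div_le_one_div_of_le (by positivity) ?_
    simpa using Real.rpow_le_rpow_of_exponent_le hL (show (3 : ℝ) / 4 ≤ 1 by norm_num)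
  have hSpi : S / Real.pi ≤ 1 := by
    rw [div_le_one hpi]
    linarith [Real.sin_le_one (Real.pi * (1 / 4)), Real.pi_gt_three]
  have hsin : sin (Real.pi * (1 / 4)) = S := by
    rw [hS]
    push_cast
    rfl
  rw [hsin, heq, norm_real, Real.norm_eq_abs, abs_mul, abs_of_nonneg (by positivity)]
  calc S / Real.pi * Real.sqrt x
        * |J - Real.log x ^ ((1 : ℝ) / 4 - 1) * Real.Gamma (1 - 1 / 4)|
      ≤ 1 * Real.sqrt x
        * (c ^ (-(1 / 4) : ℝ) * (x ^ (-c / 2) * (1 / Real.log x ^ ((3 : ℝ) / 4)))) := by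
        refine mul_le_mul (by gcongr) (hT.trans ?_) (abs_nonneg _) (by positivity)
        rw [div_eq_mul_one_div (Real.exp _)]
        gcongr
    _ = _ := by ring

end
end

section
/- Let χ be a non-principal Dirichlet character satisfying GRH, fix c ∈ (0,1/6) and ε > 0. Then there is a constant C = C(χ,c,ε) such that for every non-trivial zero ρ = 1/2 + iγ of L(s,χ), every x ≥ 3 and every sufficiently small r ∈ (0,1), ∫_{H_ρ} |L(s,χ)| |log(s − ρ)| x^{Re s} |ds| ≤ C √x (|γ| + 1)^{c+ε} (log log x/(log x)² + log(1/r)·r²·x^r), where log(s − ρ) is the branch with −π < arg(s − ρ) ≤ π on the contour. -/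
open Complex Filter
open scoped Classical

noncomputable section

lemma norm_le_exp_three_circles {f : ℂ → ℂ} {r₀ ρ₀ r₁ R K M : ℝ} (hr₀ : 0 < r₀) (hrρ : r₀ < ρ₀)
    (hρR : ρ₀ ≤ R) (hr₁ : r₀ < r₁) (hr₁R : r₁ < R) (hK : 0 < K) (hM : 0 < M)
    (hf : DifferentiableOn ℂ f (Metric.ball 0 R)) (hf0 : f 0 = 1)
    (hne : ∀ z ∈ Metric.ball (0 : ℂ) R, f z ≠ 0)
    (hfK : ∀ z ∈ Metric.ball (0 : ℂ) ρ₀, ‖f z‖ ≤ Real.exp K)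
    (hfM : ∀ z ∈ Metric.ball (0 : ℂ) R, ‖f z‖ ≤ Real.exp M)
    {z : ℂ} (hz₀ : r₀ ≤ ‖z‖) (hz₁ : ‖z‖ ≤ r₁) :
    ‖f z‖ ≤ Real.exp ((2 * K * r₀ / (ρ₀ - r₀)) ^
        (1 - (Real.log ‖z‖ - Real.log r₀) / (Real.log r₁ - Real.log r₀)) *
      (2 * M * r₁ / (R - r₁)) ^
        ((Real.log ‖z‖ - Real.log r₀) / (Real.log r₁ - Real.log r₀))) := by
  have hR : 0 < R := by linarith
  have hd : DifferentiableOn ℂ (fun z => deriv f z / f z) (Metric.ball 0 R) :=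
    (hf.deriv Metric.isOpen_ball).div hf hne
  obtain ⟨g, hg0, hg⟩ := hd.isExactOn_ball.with_val_at 0 0
  have hgd : DifferentiableOn ℂ g (Metric.ball 0 R) := fun z hz =>
    (hg z hz).differentiableAt.differentiableWithinAt
  have hexp : ∀ z ∈ Metric.ball (0 : ℂ) R, f z = Complex.exp (g z) := by
    have h1 : ∀ z ∈ Metric.ball (0 : ℂ) R,
        HasDerivAt (fun z => f z * Complex.exp (-g z)) 0 z := by
      intro z hz
      have h2 := (hf.differentiableAt (Metric.isOpen_ball.mem_nhds hz)).hasDerivAt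
      refine (h2.fun_mul ((hg z hz).fun_neg.cexp)).congr_deriv ?_
      have := hne z hz
      field_simp
      ring
    intro z hz
    have h3 := (convex_ball (0 : ℂ) R).is_const_of_fderivWithin_eq_zero (𝕜 := ℂ)
      (f := fun z => f z * Complex.exp (-g z))
      (fun w hw => (h1 w hw).differentiableAt.differentiableWithinAt)
      (fun w hw => by
        rw [fderivWithin_of_isOpen Metric.isOpen_ball hw]
        ext
        simp [(h1 w hw).deriv]) hz (Metric.mem_ball_self hR)
    simp only [hf0, hg0, neg_zero, Complex.exp_zero, mul_one] at h3
    rw [Complex.exp_neg] at h3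
    field_simp at h3
    exact h3
  have hre : ∀ z ∈ Metric.ball (0 : ℂ) R, ‖f z‖ = Real.exp (g z).re := fun z hz => by
    rw [hexp z hz, Complex.norm_exp]
  have hb : ∀ {S B r : ℝ}, 0 < B → S ≤ R → 0 < r → r < S →
      (∀ z ∈ Metric.ball (0 : ℂ) S, ‖f z‖ ≤ Real.exp B) →
      ∀ w : ℂ, ‖w‖ = r → ‖g w‖ ≤ 2 * B * r / (S - r) := by
    intro S B r hB hSR hr hrS hfB w hw
    have := Complex.borelCaratheodory_zero (f := g) (z := w) hB
      (hgd.mono (Metric.ball_subset_ball hSR))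
      (fun y hy => by
        have := hfB y hy
        rw [hre y (Metric.ball_subset_ball hSR hy)] at this
        exact Real.exp_le_exp.mp this) (hr.trans hrS) (by simpa [hw] using hrS) hg0
    rwa [hw] at this
  have hlog : Real.log r₀ < Real.log r₁ := Real.log_lt_log hr₀ hr₁
  have hzpos : 0 < ‖z‖ := hr₀.trans_le hz₀
  have hz0 : z ≠ 0 := norm_pos_iff.mp hzpos
  have hr₁pos : 0 < r₁ := hr₀.trans hr₁
  have hnle : ∀ w : ℂ, w.re ≤ Real.log r₁ → Complex.exp w ∈ Metric.ball (0 : ℂ) R := by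
    intro w hw
    rw [mem_ball_zero_iff, Complex.norm_exp]
    calc Real.exp w.re ≤ Real.exp (Real.log r₁) := Real.exp_le_exp.mpr hw
      _ = r₁ := Real.exp_log hr₁pos
      _ < R := hr₁R
  have hcl : closure (Complex.HadamardThreeLines.verticalStrip (Real.log r₀) (Real.log r₁)) ⊆
      {w : ℂ | w.re ≤ Real.log r₁} :=
    closure_minimal (fun w hw => hw.2.le) (isClosed_le Complex.continuous_re continuous_const)
  have key := Complex.HadamardThreeLines.norm_le_interp_of_mem_verticalClosedStrip'
    (f := fun w => g (Complex.exp w)) (z := Complex.log z) (l := Real.log r₀) (u := Real.log r₁)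
    (a := 2 * K * r₀ / (ρ₀ - r₀)) (b := 2 * M * r₁ / (R - r₁)) hlog
    (by
      rw [Complex.HadamardThreeLines.verticalClosedStrip, Set.mem_preimage, Complex.log_re]
      exact ⟨Real.log_le_log hr₀ hz₀, Real.log_le_log hzpos hz₁⟩)
    (by
      apply DifferentiableOn.diffContOnCl
      refine hgd.comp Complex.differentiable_exp.differentiableOn ?_
      exact fun w hw => hnle w (hcl hw))
    (by
      have hc := (isCompact_closedBall (0 : ℂ) r₁).image_of_continuousOn
        ((hgd.continuousOn.mono (Metric.closedBall_subset_ball hr₁R)).norm)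
      refine hc.bddAbove.mono ?_
      rintro _ ⟨w, hw, rfl⟩
      refine ⟨Complex.exp w, ?_, rfl⟩
      rw [mem_closedBall_zero_iff, Complex.norm_exp]
      calc Real.exp w.re ≤ Real.exp (Real.log r₁) := Real.exp_le_exp.mpr hw.2
        _ = r₁ := Real.exp_log hr₁pos)
    (fun w hw => hb hK hρR hr₀ hrρ hfK _ (by
      rw [Complex.norm_exp, show w.re = Real.log r₀ from hw, Real.exp_log hr₀]))
    (fun w hw => hb hM le_rfl hr₁pos hr₁R hfM _ (by
      rw [Complex.norm_exp, show w.re = Real.log r₁ from hw, Real.exp_log hr₁pos]))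
  rw [Complex.log_re] at key
  simp only [Complex.exp_log hz0] at key
  rw [hre z (mem_ball_zero_iff.mpr (hz₁.trans_lt hr₁R))]
  exact Real.exp_le_exp.mpr ((Complex.re_le_norm _).trans key)

lemma exists_rpow_mul_rpow_le {θ A lam : ℝ} (hθ : 0 < θ) (hθ1 : θ < 1) (hA : 0 < A)
    (hlam : 0 < lam) : ∃ C : ℝ, 0 ≤ C ∧ ∀ b : ℝ, 0 ≤ b → A ^ (1 - θ) * b ^ θ ≤ C + lam * b := by
  refine ⟨A * lam ^ (-(θ / (1 - θ))), by positivity, fun b hb => ?_⟩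
  have h1 : 0 < 1 - θ := by linarith
  have hp : 0 < A * lam ^ (-(θ / (1 - θ))) := by positivity
  have h := Real.geom_mean_le_arith_mean2_weighted h1.le hθ.le hp.le
    (mul_nonneg hlam.le hb) (by ring)
  have h2 : (A * lam ^ (-(θ / (1 - θ)))) ^ (1 - θ) * (lam * b) ^ θ = A ^ (1 - θ) * b ^ θ := by
    rw [Real.mul_rpow hA.le (by positivity), Real.mul_rpow hlam.le hb, ← Real.rpow_mul hlam.le,
      show -(θ / (1 - θ)) * (1 - θ) = -θ by field_simp, Real.rpow_neg hlam.le]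
    have : lam ^ θ ≠ 0 := (Real.rpow_pos_of_pos hlam _).ne'
    field_simp
  rw [h2] at h
  have h3 : (1 - θ) * (A * lam ^ (-(θ / (1 - θ)))) ≤ A * lam ^ (-(θ / (1 - θ))) :=
    mul_le_of_le_one_left hp.le (by linarith)
  have h4 : θ * (lam * b) ≤ lam * b := mul_le_of_le_one_left (by positivity) hθ1.le
  linarith

lemma exists_norm_sum_Icc_le {N : ℕ} [NeZero N] {Φ : ZMod N → ℂ} (hΦ : ∑ j, Φ j = 0) :
    ∃ C : ℝ, 0 ≤ C ∧ ∀ n : ℕ, ‖∑ k ∈ Finset.Icc 1 n, Φ (k : ZMod N)‖ ≤ C := by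
  set S : ℕ → ℂ := fun n => ∑ k ∈ Finset.range n, Φ (k : ZMod N) with hS
  have h0 : S N = 0 := by
    rw [← hΦ, hS]
    refine Finset.sum_bij' (fun k _ => (k : ZMod N)) (fun j _ => j.val) ?_ ?_ ?_ ?_ ?_
    · simp
    · exact fun j _ => Finset.mem_range.mpr j.val_lt
    · exact fun k hk => ZMod.val_cast_of_lt (Finset.mem_range.mp hk)
    · simp
    · simp
  have hper : Function.Periodic S N := by
    intro n
    induction n with
    | zero => simp [h0]; simp [hS]
    | succ n ih =>
      have : n + 1 + N = n + N + 1 := by ring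
      rw [this]
      simp only [hS] at ih ⊢
      rw [Finset.sum_range_succ, Finset.sum_range_succ, ih]
      simp
  refine ⟨∑ m ∈ Finset.range N, ‖S m‖ + ‖Φ 0‖, by positivity, fun n => ?_⟩
  have h1 : ∑ k ∈ Finset.Icc 1 n, Φ (k : ZMod N) = S (n + 1) - Φ 0 := by
    simp only [hS]
    rw [Finset.range_eq_Ico, Finset.sum_eq_sum_Ico_succ_bot (by omega)]
    simp [Finset.Ico_add_one_right_eq_Icc]
  rw [h1, ← hper.map_mod_nat]
  refine (norm_sub_le _ _).trans (add_le_add_left ?_ _)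
  exact Finset.single_le_sum (f := fun m => ‖S m‖) (fun _ _ => norm_nonneg _)
    (Finset.mem_range.mpr (Nat.mod_lt _ (NeZero.pos N)))

lemma exists_norm_LFunction_le_of_one_lt {N : ℕ} [NeZero N] (Φ : ZMod N → ℂ) {σ : ℝ} (hσ : 1 < σ) :
    ∃ C : ℝ, 0 < C ∧ ∀ s : ℂ, σ ≤ s.re → ‖ZMod.LFunction Φ s‖ ≤ C := by
  have hsum : LSeriesSummable (Φ ·) (σ : ℂ) := ZMod.LSeriesSummable_of_one_lt_re Φ (by simpa)
  refine ⟨∑' n, ‖LSeries.term (Φ ·) (σ : ℂ) n‖ + 1, by positivity, fun s hs => ?_⟩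
  rw [ZMod.LFunction_eq_LSeries Φ (hσ.trans_le hs), LSeries]
  refine (tsum_of_norm_bounded hsum.norm.hasSum fun n => ?_).trans (by linarith)
  exact LSeries.norm_term_le_of_re_le_re _ (by simpa) n

lemma exists_norm_LFunction_le_of_re_pos {N : ℕ} [NeZero N] {Φ : ZMod N → ℂ}
    (hΦ : ∑ j, Φ j = 0) :
    ∃ C : ℝ, 0 ≤ C ∧ ∀ s : ℂ, 0 < s.re → ‖ZMod.LFunction Φ s‖ ≤ C * ‖s‖ / s.re := by
  obtain ⟨C, hC0, hC⟩ := exists_norm_sum_Icc_le hΦ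
  refine ⟨C, hC0, ?_⟩
  set S : ℝ → ℂ := fun t => ∑ k ∈ Finset.Icc 1 ⌊t⌋₊, Φ (k : ZMod N) with hS
  have hSb : ∀ t, ‖S t‖ ≤ C := fun t => hC _
  have hSm : Measurable S := by
    have : Measurable fun n : ℕ => ∑ k ∈ Finset.Icc 1 n, Φ (k : ZMod N) := measurable_from_top
    exact this.comp Nat.measurable_floor
  have hS1 : ∀ t < 1, S t = 0 := by
    intro t ht
    simp [hS, Nat.floor_eq_zero.mpr ht]
  have hmel : ∀ s : ℂ, mellin S (-s) =
      ∫ t in Set.Ioi (1 : ℝ), S t * (t : ℂ) ^ (-(s + 1)) := by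
    intro s
    rw [mellin, ← MeasureTheory.integral_Ici_eq_integral_Ioi (x := (1 : ℝ)),
      MeasureTheory.setIntegral_eq_of_subset_of_forall_sdiff_eq_zero (s := Set.Ici 1)
        (t := Set.Ioi 0)
        measurableSet_Ioi (Set.Ici_subset_Ioi.mpr one_pos)]
    · refine MeasureTheory.setIntegral_congr_fun measurableSet_Ici fun t _ => ?_
      simp only [smul_eq_mul]
      rw [mul_comm, show -s - 1 = -(s + 1) by ring]
    · intro t ht
      rw [hS1 t (not_le.mp ht.2), smul_zero]
  have hdiff : ∀ s : ℂ, 0 < s.re → DifferentiableAt ℂ (mellin S) (-s) := by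
    intro s hs
    refine mellin_differentiableAt_of_isBigO_rpow (a := 0) (b := -s.re - 1) ?_ ?_ (by simpa) ?_
      (by simp)
    · refine MeasureTheory.LocallyIntegrable.locallyIntegrableOn ?_ _
      exact (MeasureTheory.locallyIntegrable_const C).mono hSm.aestronglyMeasurable
        (Filter.Eventually.of_forall fun t => (hSb t).trans (Real.le_norm_self C))
    · refine Asymptotics.IsBigO.of_bound C (Filter.Eventually.of_forall fun t => ?_)
      simpa using hSb t
    · refine Asymptotics.IsBigO.of_bound 0 ?_
      filter_upwards [mem_nhdsWithin_of_mem_nhds (Iio_mem_nhds (zero_lt_one' ℝ))] with t ht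
      rw [hS1 t ht]
      simp
  have heq : ∀ s : ℂ, 1 < s.re → ZMod.LFunction Φ s = s * mellin S (-s) := by
    intro s hs
    rw [ZMod.LFunction_eq_LSeries Φ hs, hmel, LSeries_eq_mul_integral _ le_rfl
      (zero_lt_one.trans hs)
      (ZMod.LSeriesSummable_of_one_lt_re Φ hs)]
    refine Asymptotics.IsBigO.of_bound C (Filter.Eventually.of_forall fun n => ?_)
    simpa using hC n
  have hopen : IsOpen {s : ℂ | 0 < s.re} := isOpen_lt continuous_const Complex.continuous_re
  have hext : ∀ s : ℂ, 0 < s.re → ZMod.LFunction Φ s = s * mellin S (-s) := by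
    have h1 : AnalyticOnNhd ℂ (ZMod.LFunction Φ) {s : ℂ | 0 < s.re} :=
      (ZMod.differentiable_LFunction_of_sum_zero hΦ).differentiableOn.analyticOnNhd hopen
    have h2 : AnalyticOnNhd ℂ (fun s => s * mellin S (-s)) {s : ℂ | 0 < s.re} := by
      refine DifferentiableOn.analyticOnNhd (fun s hs => ?_) hopen
      exact (differentiableAt_id.mul
        ((hdiff s hs).comp s differentiableAt_id.neg)).differentiableWithinAt
    have h3 := h1.eqOn_of_preconnected_of_eventuallyEq h2
      (convex_halfSpace_re_gt 0).isPreconnected (z₀ := 2) (by simp) (by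
        have : {s : ℂ | 1 < s.re} ∈ nhds (2 : ℂ) :=
          (isOpen_lt continuous_const Complex.continuous_re).mem_nhds (by simp)
        filter_upwards [this] with s hs using heq s hs)
    exact fun s hs => h3 hs
  intro s hs
  rw [hext s hs, norm_mul, hmel, mul_comm C, mul_div_assoc]
  refine mul_le_mul_of_nonneg_left ?_ (norm_nonneg _)
  have hmaj : MeasureTheory.IntegrableOn (fun t : ℝ => C * t ^ (-(s.re + 1))) (Set.Ioi 1) :=
    (integrableOn_Ioi_rpow_of_lt (by linarith) one_pos).const_mul C
  refine (MeasureTheory.norm_integral_le_of_norm_le hmaj ?_).trans_eq ?_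
  · refine (MeasureTheory.ae_restrict_iff' measurableSet_Ioi).mpr
      (Filter.Eventually.of_forall fun t ht => ?_)
    rw [norm_mul, Complex.norm_cpow_eq_rpow_re_of_pos (zero_lt_one.trans ht)]
    simp only [Complex.neg_re, Complex.add_re, Complex.one_re]
    exact mul_le_mul_of_nonneg_right (hSb t) (Real.rpow_nonneg (zero_lt_one.trans ht).le _)
  · rw [MeasureTheory.integral_const_mul, integral_Ioi_rpow_of_lt (by linarith) one_pos,
      Real.one_rpow, show -(s.re + 1) + 1 = -s.re by ring]
    field_simp

lemma norm_Gamma_le_Gamma_re {s : ℂ} (hs : 0 < s.re) : ‖Complex.Gamma s‖ ≤ Real.Gamma s.re := by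
  rw [Complex.Gamma_eq_integral hs, Complex.GammaIntegral, Real.Gamma_eq_integral hs]
  refine (MeasureTheory.norm_integral_le_integral_norm _).trans_eq ?_
  refine MeasureTheory.setIntegral_congr_fun measurableSet_Ioi fun x hx => ?_
  simp only [norm_mul]
  rw [Complex.norm_cpow_eq_rpow_re_of_pos hx, Complex.norm_real,
    Real.norm_of_nonneg (Real.exp_pos _).le]
  simp

lemma norm_Gamma_one_half_add (t : ℝ) :
    ‖Complex.Gamma (1 / 2 + t * I)‖ * Real.exp (Real.pi * |t| / 2) ≤ Real.sqrt (2 * Real.pi) := by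
  have h1 := Complex.Gamma_mul_Gamma_one_sub (1 / 2 + t * I)
  have h2 : (1 : ℂ) - (1 / 2 + t * I) = (starRingEnd ℂ) (1 / 2 + t * I) := by
    simp [Complex.ext_iff]
    norm_num
  rw [h2, Complex.Gamma_conj, Complex.mul_conj, Complex.normSq_eq_norm_sq] at h1
  have h3 : Complex.sin (Real.pi * (1 / 2 + t * I)) = (Real.cosh (Real.pi * t) : ℂ) := by
    rw [show (Real.pi : ℂ) * (1 / 2 + t * I) = (Real.pi * t : ℝ) * I + Real.pi / 2 by
      push_cast; ring, Complex.sin_add_pi_div_two, Complex.cos_mul_I]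
    simp
  rw [h3] at h1
  have h4 : ‖Complex.Gamma (1 / 2 + t * I)‖ ^ 2 = Real.pi / Real.cosh (Real.pi * t) := by
    exact_mod_cast h1
  have h5 : Real.exp (Real.pi * |t|) ≤ 2 * Real.cosh (Real.pi * t) := by
    rw [← Real.cosh_abs, abs_mul, abs_of_pos Real.pi_pos, Real.cosh_eq]
    linarith [Real.exp_pos (-(Real.pi * |t|))]
  apply Real.le_sqrt_of_sq_le
  rw [mul_pow, h4, ← Real.exp_nat_mul, div_mul_eq_mul_div, div_le_iff₀ (Real.cosh_pos _),
    show ((2 : ℕ) : ℝ) * (Real.pi * |t| / 2) = Real.pi * |t| by push_cast; ring]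
  nlinarith [Real.pi_pos]

lemma norm_Gamma_three_halves_add (t : ℝ) :
    ‖Complex.Gamma (3 / 2 + t * I)‖ * Real.exp (Real.pi * |t| / 2) ≤
      Real.sqrt (2 * Real.pi) * (1 + |t|) := by
  have h0 : (1 / 2 + t * I : ℂ) ≠ 0 := by
    intro h
    have := congrArg Complex.re h
    norm_num at this
  rw [show (3 / 2 + t * I : ℂ) = 1 / 2 + t * I + 1 by ring, Complex.Gamma_add_one _ h0, norm_mul]
  have h1 : ‖(1 / 2 + t * I : ℂ)‖ ≤ 1 + |t| := by
    refine (norm_add_le _ _).trans ?_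
    simp
    norm_num
  calc _ = ‖(1 / 2 + t * I : ℂ)‖ *
        (‖Complex.Gamma (1 / 2 + t * I)‖ * Real.exp (Real.pi * |t| / 2)) := by ring
    _ ≤ (1 + |t|) * Real.sqrt (2 * Real.pi) := by
        gcongr
        exact norm_Gamma_one_half_add t
    _ = _ := by ring

lemma norm_LFunction_one_sub_le {N : ℕ} [NeZero N] {Φ : ZMod N → ℂ} (hΦ0 : Φ 0 = 0) {s : ℂ}
    (hs : 0 < s.re) (hs' : s.re ≤ 2) :
    ‖ZMod.LFunction Φ (1 - s)‖ ≤ N * (‖Complex.Gamma s‖ * Real.exp (Real.pi * |s.im| / 2)) *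
      (‖ZMod.LFunction (ZMod.dft Φ) s‖ + ‖ZMod.LFunction (ZMod.dft fun x ↦ Φ (-x)) s‖) := by
  rw [ZMod.LFunction_one_sub Φ (fun n h => by
    have := congrArg Complex.re h
    simp only [Complex.neg_re, Complex.natCast_re] at this
    linarith [(Nat.cast_nonneg n : (0 : ℝ) ≤ n)]) (Or.inl hΦ0)]
  have hN : (1 : ℝ) ≤ N := Nat.one_le_cast.mpr (NeZero.one_le)
  have h1 : ‖(N : ℂ) ^ (s - 1)‖ ≤ N := by
    rw [Complex.norm_natCast_cpow_of_pos (NeZero.pos N)]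
    calc (N : ℝ) ^ (s - 1).re ≤ (N : ℝ) ^ (1 : ℝ) :=
          Real.rpow_le_rpow_of_exponent_le hN (by simp; linarith)
      _ = N := Real.rpow_one _
  have h2 : ‖(2 * Real.pi : ℂ) ^ (-s)‖ ≤ 1 := by
    rw [show (2 * Real.pi : ℂ) = ((2 * Real.pi : ℝ) : ℂ) by push_cast; rfl,
      Complex.norm_cpow_eq_rpow_re_of_pos (by positivity)]
    exact Real.rpow_le_one_of_one_le_of_nonpos (by linarith [Real.pi_gt_three]) (by simp; linarith)
  have h3 : ‖Complex.exp (Real.pi * I * s / 2)‖ ≤ Real.exp (Real.pi * |s.im| / 2) := by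
    rw [Complex.norm_exp, Real.exp_le_exp,
      show (Real.pi * I * s / 2 : ℂ) = (Real.pi / 2 : ℝ) * (I * s) by push_cast; ring,
      Complex.re_ofReal_mul]
    simp only [Complex.I_mul_re]
    nlinarith [Real.pi_pos, neg_abs_le s.im]
  have h4 : ‖Complex.exp (-Real.pi * I * s / 2)‖ ≤ Real.exp (Real.pi * |s.im| / 2) := by
    rw [Complex.norm_exp, Real.exp_le_exp,
      show (-Real.pi * I * s / 2 : ℂ) = (-Real.pi / 2 : ℝ) * (I * s) by push_cast; ring,
      Complex.re_ofReal_mul]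
    simp only [Complex.I_mul_re]
    nlinarith [Real.pi_pos, le_abs_self s.im]
  rw [norm_mul, norm_mul, norm_mul]
  set E := Real.exp (Real.pi * |s.im| / 2)
  calc _ ≤ N * 1 * ‖Complex.Gamma s‖ * (E * ‖ZMod.LFunction (ZMod.dft Φ) s‖ +
        E * ‖ZMod.LFunction (ZMod.dft fun x ↦ Φ (-x)) s‖) := by
        gcongr
        refine (norm_add_le _ _).trans ?_
        rw [norm_mul, norm_mul]
        gcongr
    _ = _ := by ring

lemma exists_norm_LFunction_neg_half_le {N : ℕ} [NeZero N] {Φ : ZMod N → ℂ} (hΦ0 : Φ 0 = 0) :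
    ∃ C : ℝ, 0 < C ∧ ∀ s : ℂ, s.re = -1 / 2 → ‖ZMod.LFunction Φ s‖ ≤ C * (1 + |s.im|) := by
  obtain ⟨C₁, hC₁0, hC₁⟩ := exists_norm_LFunction_le_of_one_lt (ZMod.dft Φ)
    (show (1 : ℝ) < 3 / 2 by norm_num)
  obtain ⟨C₂, hC₂0, hC₂⟩ := exists_norm_LFunction_le_of_one_lt (ZMod.dft fun x ↦ Φ (-x))
    (show (1 : ℝ) < 3 / 2 by norm_num)
  have hN : (0 : ℝ) < N := Nat.cast_pos.mpr (NeZero.pos N)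
  have hpi := Real.pi_pos
  refine ⟨N * Real.sqrt (2 * Real.pi) * (C₁ + C₂), by positivity, fun s hs => ?_⟩
  have hre : (1 - s).re = 3 / 2 := by simp [hs]; norm_num
  have him : (1 - s).im = -s.im := by simp
  have h := norm_LFunction_one_sub_le hΦ0 (s := 1 - s) (by rw [hre]; norm_num)
    (by rw [hre]; norm_num)
  have h2 := norm_Gamma_three_halves_add (1 - s).im
  rw [show (3 / 2 + (1 - s).im * I : ℂ) = 1 - s by
    conv_rhs => rw [← Complex.re_add_im (1 - s), hre]
    push_cast; ring] at h2
  rw [sub_sub_cancel] at h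
  calc _ ≤ _ := h
    _ ≤ N * (Real.sqrt (2 * Real.pi) * (1 + |(1 - s).im|)) * (C₁ + C₂) := by
        gcongr
        · exact hC₁ _ hre.ge
        · exact hC₂ _ hre.ge
    _ = _ := by rw [him, abs_neg]; ring

lemma sum_dft_eq_zero {N : ℕ} [NeZero N] {Φ : ZMod N → ℂ} (hΦ0 : Φ 0 = 0) :
    ∑ j, ZMod.dft Φ j = 0 := by
  rw [← ZMod.dft_apply_zero, ZMod.dft_dft]
  simp [hΦ0]

lemma exists_norm_LFunction_le_exp {N : ℕ} [NeZero N] {Φ : ZMod N → ℂ} (hΦ0 : Φ 0 = 0)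
    (hΦ : ∑ j, Φ j = 0) :
    ∃ C : ℝ, 0 < C ∧ ∀ s : ℂ, -1 / 2 ≤ s.re → s.re ≤ 3 / 2 →
      ‖ZMod.LFunction Φ s‖ ≤ C * (1 + |s.im|) * Real.exp (Real.pi * |s.im| / 2) := by
  have key : ∀ Ψ : ZMod N → ℂ, ∑ j, Ψ j = 0 → ∃ C : ℝ, 0 < C ∧ ∀ s : ℂ, 1 / 2 ≤ s.re →
      s.re ≤ 3 / 2 → ‖ZMod.LFunction Ψ s‖ ≤ C * (1 + |s.im|) := by
    intro Ψ hΨ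
    obtain ⟨C, hC0, hC⟩ := exists_norm_LFunction_le_of_re_pos hΨ
    refine ⟨4 * C + 1, by positivity, fun s hs hs' => ?_⟩
    have h1 : ‖s‖ ≤ 3 / 2 + |s.im| := by
      refine (Complex.norm_le_abs_re_add_abs_im s).trans ?_
      rw [abs_of_pos (by linarith)]
      linarith
    refine (hC s (by linarith)).trans ?_
    rw [div_le_iff₀ (by linarith)]
    have h2 := abs_nonneg s.im
    calc C * ‖s‖ ≤ C * (3 / 2 + |s.im|) := by gcongr
      _ ≤ (4 * C + 1) * (1 + |s.im|) * (1 / 2) := by nlinarith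
      _ ≤ _ := by gcongr
  obtain ⟨C₀, hC₀0, hC₀⟩ := key Φ hΦ
  obtain ⟨C₁, hC₁0, hC₁⟩ := key (ZMod.dft Φ) (sum_dft_eq_zero hΦ0)
  obtain ⟨C₂, hC₂0, hC₂⟩ := key (ZMod.dft fun x ↦ Φ (-x)) (sum_dft_eq_zero (by simpa using hΦ0))
  obtain ⟨G, hG⟩ := (isCompact_Icc (a := (1 / 2 : ℝ)) (b := 3 / 2)).exists_bound_of_continuousOn
    (f := Real.Gamma) (fun x hx => by
      refine (Real.differentiableAt_Gamma fun m => ?_).continuousAt.continuousWithinAt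
      have : (0 : ℝ) ≤ m := Nat.cast_nonneg m
      linarith [hx.1])
  have hG0 : 0 ≤ G := (norm_nonneg _).trans (hG 1 (by constructor <;> norm_num))
  have hN : (0 : ℝ) < N := Nat.cast_pos.mpr (NeZero.pos N)
  refine ⟨C₀ + N * G * (C₁ + C₂), by positivity, fun s hs hs' => ?_⟩
  have h0 : 1 ≤ Real.exp (Real.pi * |s.im| / 2) := Real.one_le_exp (by positivity)
  have h01 := abs_nonneg s.im
  rcases le_total (1 / 2) s.re with h | h
  · calc _ ≤ C₀ * (1 + |s.im|) := hC₀ s h hs'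
      _ ≤ (C₀ + N * G * (C₁ + C₂)) * (1 + |s.im|) * 1 := by
          rw [mul_one]
          gcongr
          exact le_add_of_nonneg_right (by positivity)
      _ ≤ _ := by gcongr
  · have hre : (1 - s).re = 1 - s.re := by simp
    have him : |(1 - s).im| = |s.im| := by simp
    have h1 : 1 / 2 ≤ (1 - s).re := by rw [hre]; linarith
    have h2 : (1 - s).re ≤ 3 / 2 := by rw [hre]; linarith
    have h3 := norm_LFunction_one_sub_le hΦ0 (s := 1 - s) (by linarith) (by linarith)
    rw [sub_sub_cancel] at h3
    have h4 : ‖Complex.Gamma (1 - s)‖ ≤ G :=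
      (norm_Gamma_le_Gamma_re (by linarith)).trans ((Real.le_norm_self _).trans (hG _ ⟨h1, h2⟩))
    have h5 := hC₁ _ h1 h2
    have h6 := hC₂ _ h1 h2
    rw [him] at h3 h5 h6
    calc _ ≤ _ := h3
      _ ≤ N * (G * Real.exp (Real.pi * |s.im| / 2)) *
          (C₁ * (1 + |s.im|) + C₂ * (1 + |s.im|)) := by gcongr
      _ = (0 + N * G * (C₁ + C₂)) * (1 + |s.im|) * Real.exp (Real.pi * |s.im| / 2) := by ring
      _ ≤ _ := by gcongr

lemma one_fourth_le_norm_LFunction {N : ℕ} [NeZero N] (χ : DirichletCharacter ℂ N) {s : ℂ}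
    (hs : s.re = 2) : 1 / 4 ≤ ‖DirichletCharacter.LFunction χ s‖ := by
  have hs1 : 1 < s.re := by rw [hs]; norm_num
  rw [DirichletCharacter.LFunction_eq_LSeries χ hs1]
  have hsum : Summable (LSeries.term (χ ·) s) := χ.LSeriesSummable_of_one_lt_re hs1
  have hz := hasSum_zeta_two
  have hz2 : Summable fun n : ℕ => 1 / ((n + 2 : ℕ) : ℝ) ^ 2 :=
    (summable_nat_add_iff 2).2 hz.summable
  have hz3 : ∑' n : ℕ, 1 / ((n + 2 : ℕ) : ℝ) ^ 2 = Real.pi ^ 2 / 6 - 1 := by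
    have := hz.summable.sum_add_tsum_nat_add 2
    rw [hz.tsum_eq] at this
    norm_num [Finset.sum_range_succ] at this ⊢
    linarith
  have hb : ∀ n : ℕ, ‖LSeries.term (χ ·) s (n + 2)‖ ≤ 1 / ((n + 2 : ℕ) : ℝ) ^ 2 := by
    intro n
    rw [LSeries.norm_term_eq, if_neg (by omega), hs]
    rw [show ((2 : ℝ)) = ((2 : ℕ) : ℝ) by norm_num, Real.rpow_natCast]
    gcongr
    exact χ.norm_le_one _
  have h1 := tsum_of_norm_bounded hz2.hasSum hb
  have h2 := hsum.sum_add_tsum_nat_add 2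
  have h3 : ∑ n ∈ Finset.range 2, LSeries.term (χ ·) s n = 1 := by
    simp [Finset.sum_range_succ, LSeries.term_def]
  rw [LSeries, ← h2, h3]
  rw [hz3] at h1
  have h4 := norm_sub_le_norm_add (1 : ℂ) (∑' n, LSeries.term (χ ·) s (n + 2))
  rw [norm_one] at h4
  have := Real.pi_lt_d2
  have := Real.pi_pos
  nlinarith

lemma exists_norm_LFunction_le_rpow {N : ℕ} [NeZero N] {χ : DirichletCharacter ℂ N} (hχ : χ ≠ 1)
    (hz : ∀ s : ℂ, 1 / 2 < s.re → DirichletCharacter.LFunction χ s ≠ 0) {η ε : ℝ} (hη : 0 < η)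
    (hη1 : η < 1) (hε : 0 < ε) :
    ∃ C : ℝ, 0 < C ∧ ∀ s : ℂ, s.re = 1 / 2 + η →
      ‖DirichletCharacter.LFunction χ s‖ ≤ C * (1 + |s.im|) ^ ε := by
  have hsum : ∑ j, χ j = 0 := MulChar.sum_eq_zero_of_ne_one hχ
  have hd : Differentiable ℂ (DirichletCharacter.LFunction χ) :=
    DirichletCharacter.differentiable_LFunction hχ
  obtain ⟨C₁, hC₁0, hC₁⟩ := exists_norm_LFunction_le_of_one_lt (χ : ZMod N → ℂ)
    (show (1 : ℝ) < 5 / 4 by norm_num)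
  obtain ⟨C₂, hC₂0, hC₂⟩ := exists_norm_LFunction_le_of_re_pos hsum
  change ∀ s : ℂ, _ → ‖DirichletCharacter.LFunction χ s‖ ≤ _ at hC₁ hC₂
  set r₁ := 3 / 2 - η / 2 with hr₁
  set θ := (Real.log (3 / 2 - η) - Real.log (1 / 2)) / (Real.log r₁ - Real.log (1 / 2)) with hθ
  have hl1 : Real.log (1 / 2) < Real.log (3 / 2 - η) :=
    Real.log_lt_log (by norm_num) (by linarith)
  have hl2 : Real.log (3 / 2 - η) < Real.log r₁ :=
    Real.log_lt_log (by linarith) (by rw [hr₁]; linarith)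
  have hθ0 : 0 < θ := div_pos (by linarith) (by linarith)
  have hθ1 : θ < 1 := (div_lt_one (by linarith)).2 (by linarith)
  obtain ⟨C, hC0, hC⟩ := exists_rpow_mul_rpow_le hθ0 hθ1
    (show 0 < 2 * (4 * C₁) * (1 / 2) / (3 / 4 - 1 / 2) by positivity)
    (show 0 < ε * (3 / 2 - r₁) / (2 * r₁) from
      div_pos (mul_pos hε (by linarith)) (by linarith))
  refine ⟨C₁ * Real.exp (C + ε * (32 * C₂ + 1)), by positivity, fun s hs => ?_⟩
  set t := s.im
  set s₀ : ℂ := 2 + t * I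
  have hs₀re : s₀.re = 2 := by simp [s₀]
  have hs₀im : s₀.im = t := by simp [s₀]
  have hlow := one_fourth_le_norm_LFunction χ hs₀re
  have hne : DirichletCharacter.LFunction χ s₀ ≠ 0 := by
    rw [← norm_pos_iff]; linarith
  have hbd : ∀ z {B : ℝ}, ‖DirichletCharacter.LFunction χ (s₀ + z)‖ ≤ B →
      ‖DirichletCharacter.LFunction χ (s₀ + z) / DirichletCharacter.LFunction χ s₀‖ ≤ 4 * B := by
    intro z B hB
    rw [norm_div, div_le_iff₀ (by linarith)]
    nlinarith [(norm_nonneg _).trans hB]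
  have hre : ∀ z : ℂ, ∀ ρ : ℝ, z ∈ Metric.ball (0 : ℂ) ρ → 2 - ρ < (s₀ + z).re := by
    intro z ρ h
    rw [mem_ball_zero_iff] at h
    have := (abs_le.1 (Complex.abs_re_le_norm z)).1
    rw [Complex.add_re, hs₀re]
    linarith
  have hM0 : 0 ≤ Real.log (1 + |t|) := Real.log_nonneg (by linarith [abs_nonneg t])
  have hnz : ‖-(((3 / 2 - η : ℝ)) : ℂ)‖ = 3 / 2 - η := by
    rw [norm_neg, Complex.norm_real, Real.norm_of_nonneg (by linarith)]
  have hmain := norm_le_exp_three_circles (r₀ := 1 / 2) (ρ₀ := 3 / 4) (R := 3 / 2) (r₁ := r₁)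
    (K := 4 * C₁) (M := Real.log (1 + |t|) + 32 * C₂ + 1)
    (f := fun z => DirichletCharacter.LFunction χ (s₀ + z) / DirichletCharacter.LFunction χ s₀)
    (z := -((3 / 2 - η : ℝ) : ℂ))
    (by norm_num) (by norm_num) (by norm_num) (by linarith) (by linarith) (by positivity)
    (by positivity)
    ((hd.comp (differentiable_id.const_add s₀)).div_const _).differentiableOn
    (by simp [hne])
    (fun z h => div_ne_zero (hz _ (by linarith [hre z _ h])) hne)
    (fun z h => (hbd z (hC₁ _ (by linarith [hre z _ h]))).trans
      ((le_add_of_nonneg_right zero_le_one).trans (Real.add_one_le_exp _)))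
    (fun z h => by
      have h1 := hre z _ h
      have h2 : ‖s₀ + z‖ ≤ 4 * (1 + |t|) := by
        have h3 : ‖s₀‖ ≤ 2 + |t| := by
          refine (Complex.norm_le_abs_re_add_abs_im _).trans ?_
          rw [hs₀re, hs₀im]; norm_num
        have := norm_add_le s₀ z
        rw [mem_ball_zero_iff] at h
        linarith [abs_nonneg t]
      have h3 : ‖DirichletCharacter.LFunction χ (s₀ + z)‖ ≤ 8 * C₂ * (1 + |t|) := by
        refine (hC₂ _ (by linarith)).trans ?_
        rw [div_le_iff₀ (by linarith)]
        calc C₂ * ‖s₀ + z‖ ≤ C₂ * (4 * (1 + |t|)) := by gcongr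
          _ = 8 * C₂ * (1 + |t|) * (1 / 2) := by ring
          _ ≤ _ := by gcongr; linarith
      refine (hbd z h3).trans ?_
      rw [add_assoc, Real.exp_add, Real.exp_log (by positivity)]
      have h4 := Real.add_one_le_exp (32 * C₂ + 1)
      have h5 := abs_nonneg t
      nlinarith)
    (by rw [hnz]; linarith) (by rw [hnz]; linarith)
  rw [hnz] at hmain
  have h6 := hmain.trans (Real.exp_le_exp.2 (hC _ (by
    apply div_nonneg
    · have : 0 < r₁ := by linarith
      positivity
    · linarith)))
  rw [show s₀ + -((3 / 2 - η : ℝ) : ℂ) = s by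
    rw [Complex.ext_iff]; constructor
    · simp [hs₀re, hs]; ring
    · simp [hs₀im, t], norm_div, div_le_iff₀ (by linarith)] at h6
  have hr₁0 : r₁ ≠ 0 := by linarith
  have hr₁1 : 3 / 2 - r₁ ≠ 0 := by linarith
  have h7 : ε * (3 / 2 - r₁) / (2 * r₁) * (2 * (Real.log (1 + |t|) + 32 * C₂ + 1) * r₁ /
      (3 / 2 - r₁)) = ε * (32 * C₂ + 1) + Real.log (1 + |t|) * ε := by
    generalize 3 / 2 - r₁ = d at hr₁1 ⊢
    field_simp
    ring
  rw [h7, ← add_assoc, Real.exp_add, ← Real.rpow_def_of_pos (by positivity)] at h6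
  refine h6.trans ?_
  have := hC₁ s₀ (by rw [hs₀re]; norm_num)
  calc _ ≤ Real.exp (C + ε * (32 * C₂ + 1)) * (1 + |t|) ^ ε * C₁ := by gcongr
    _ = _ := by ring

lemma norm_exp_sub_mul_I_sq (s : ℂ) (T : ℝ) :
    ‖Complex.exp ((s - T * I) ^ 2)‖ = Real.exp (s.re ^ 2 - (s.im - T) ^ 2) := by
  rw [Complex.norm_exp]
  congr 1
  simp [pow_two]

lemma one_add_abs_le_mul (t T : ℝ) : 1 + |t| ≤ (1 + |T|) * (1 + |t - T|) := by
  have h1 : |t| ≤ |T| + |t - T| := by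
    have := abs_add_le T (t - T)
    rwa [add_sub_cancel] at this
  nlinarith [abs_nonneg T, abs_nonneg (t - T), mul_nonneg (abs_nonneg T) (abs_nonneg (t - T))]

lemma one_add_mul_exp_le {σ v : ℝ} (hσ : σ ^ 2 ≤ 9 / 4) :
    (1 + |v|) * Real.exp (σ ^ 2 - v ^ 2) ≤ Real.exp 4 := by
  calc (1 + |v|) * Real.exp (σ ^ 2 - v ^ 2) ≤ Real.exp |v| * Real.exp (σ ^ 2 - v ^ 2) := by
        gcongr
        linarith [Real.add_one_le_exp |v|]
    _ ≤ Real.exp 4 := by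
        rw [← Real.exp_add, Real.exp_le_exp, ← sq_abs v]
        nlinarith [sq_nonneg (|v| - 1)]

lemma exists_norm_LFunction_le_rpow_of_le_re {N : ℕ} [NeZero N] {χ : DirichletCharacter ℂ N}
    (hχ : χ ≠ 1) (hz : ∀ s : ℂ, 1 / 2 < s.re → DirichletCharacter.LFunction χ s ≠ 0) {η ε : ℝ}
    (hη : 0 < η) (hη1 : η < 1) (hε : 0 < ε) (hε1 : ε ≤ 1) :
    ∃ C : ℝ, 0 < C ∧ ∀ s : ℂ, -1 / 2 ≤ s.re → s.re ≤ 1 / 2 + η →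
      ‖DirichletCharacter.LFunction χ s‖ ≤ C * (1 + |s.im|) ^ (1 / 2 + η - s.re + ε) := by
  have hsum : ∑ j, χ j = 0 := MulChar.sum_eq_zero_of_ne_one hχ
  have hN : N ≠ 1 := by
    rintro rfl
    exact hχ (DirichletCharacter.level_one χ)
  have hχ0 : χ 0 = 0 := DirichletCharacter.map_zero' χ hN
  have hd : Differentiable ℂ (DirichletCharacter.LFunction χ) :=
    DirichletCharacter.differentiable_LFunction hχ
  obtain ⟨A, hA0, hA⟩ := exists_norm_LFunction_neg_half_le hχ0
  obtain ⟨B, hB0, hB⟩ := exists_norm_LFunction_le_rpow hχ hz hη hη1 hε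
  obtain ⟨E, hE0, hE⟩ := exists_norm_LFunction_le_exp hχ0 hsum
  change ∀ s : ℂ, _ → ‖DirichletCharacter.LFunction χ s‖ ≤ _ at hA
  change ∀ s : ℂ, _ → _ → ‖DirichletCharacter.LFunction χ s‖ ≤ _ at hE
  refine ⟨(A + B) * Real.exp 4, by positivity, fun s hs hs' => ?_⟩
  set T := s.im
  have hT := abs_nonneg T
  set D := (A + B) * Real.exp 4
  have hsq : ∀ x : ℝ, -1 / 2 ≤ x → x ≤ 1 / 2 + η → x ^ 2 ≤ 9 / 4 := fun x h1 h2 => by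
    nlinarith
  set w := (s.re - -1 / 2) / (1 / 2 + η - -1 / 2)
  have hw0 : 0 ≤ w := div_nonneg (by linarith) (by linarith)
  have hw1 : w ≤ 1 := (div_le_one (by linarith)).2 (by linarith)
  have hw : 1 - w ≤ 1 / 2 + η - s.re := by
    have : 1 - w = (1 / 2 + η - s.re) / (1 + η) := by
      simp only [w]
      have h0 : 1 + η ≠ 0 := by linarith
      rw [show 1 / 2 + η - -1 / 2 = 1 + η by ring]
      field_simp
      ring
    rw [this]
    exact div_le_self (by linarith) (by linarith)
  have hmain := Complex.HadamardThreeLines.norm_le_interp_of_mem_verticalClosedStrip'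
    (f := fun s => DirichletCharacter.LFunction χ s * Complex.exp ((s - T * I) ^ 2)) (z := s)
    (l := -1 / 2) (u := 1 / 2 + η) (a := D * (1 + |T|)) (b := D * (1 + |T|) ^ ε)
    (by linarith) ⟨hs, hs'⟩
    (hd.mul (((differentiable_id.sub_const _).pow 2).cexp)).diffContOnCl
    (by
      refine ⟨E * (1 + |T|) * Real.exp (Real.pi * |T| / 2) * Real.exp 6, ?_⟩
      rintro _ ⟨z, ⟨hz1, hz2⟩, rfl⟩
      simp only [Function.comp, norm_mul, norm_exp_sub_mul_I_sq]
      set v := z.im - T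
      have h1 := one_add_abs_le_mul z.im T
      have hv := abs_nonneg v
      have h2 : |z.im| ≤ |T| + |v| := by
        have := abs_add_le T v
        rwa [show T + v = z.im by simp [v]] at this
      have h3 := hE z hz1 (by linarith)
      have h4 := hsq _ hz1 hz2
      calc _ ≤ E * (1 + |z.im|) * Real.exp (Real.pi * |z.im| / 2) *
            Real.exp (z.re ^ 2 - v ^ 2) := by gcongr
        _ ≤ E * ((1 + |T|) * (1 + |v|)) * Real.exp (Real.pi * (|T| + |v|) / 2) *
            Real.exp (z.re ^ 2 - v ^ 2) := by gcongr
        _ = E * (1 + |T|) * Real.exp (Real.pi * |T| / 2) * ((1 + |v|) *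
            (Real.exp (Real.pi * |v| / 2) * Real.exp (z.re ^ 2 - v ^ 2))) := by
            rw [mul_add Real.pi, add_div, Real.exp_add]; ring
        _ ≤ _ := by
            gcongr
            calc _ ≤ Real.exp |v| *
                  (Real.exp (Real.pi * |v| / 2) * Real.exp (z.re ^ 2 - v ^ 2)) := by
                  gcongr
                  linarith [Real.add_one_le_exp |v|]
              _ ≤ _ := by
                  rw [← Real.exp_add, ← Real.exp_add, Real.exp_le_exp, ← sq_abs v]
                  nlinarith [sq_nonneg (|v| - 3 / 2), Real.pi_lt_four])
    (by
      intro z hz1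
      simp only [Set.mem_preimage, Set.mem_singleton_iff] at hz1
      simp only [norm_mul, norm_exp_sub_mul_I_sq]
      calc _ ≤ A * (1 + |z.im|) * Real.exp (z.re ^ 2 - (z.im - T) ^ 2) := by
            gcongr
            exact hA z hz1
        _ ≤ A * ((1 + |T|) * (1 + |z.im - T|)) * Real.exp (z.re ^ 2 - (z.im - T) ^ 2) := by
            gcongr
            exact one_add_abs_le_mul _ _
        _ = A * (1 + |T|) * ((1 + |z.im - T|) * Real.exp (z.re ^ 2 - (z.im - T) ^ 2)) := by ring
        _ ≤ (A + B) * (1 + |T|) * Real.exp 4 := by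
            gcongr
            · linarith
            · exact one_add_mul_exp_le (hsq _ (by linarith) (by linarith))
        _ = _ := by ring)
    (by
      intro z hz1
      simp only [Set.mem_preimage, Set.mem_singleton_iff] at hz1
      simp only [norm_mul, norm_exp_sub_mul_I_sq]
      have h1 : (1 + |z.im|) ^ ε ≤ (1 + |T|) ^ ε * (1 + |z.im - T|) := by
        calc _ ≤ ((1 + |T|) * (1 + |z.im - T|)) ^ ε := by
              gcongr
              exact one_add_abs_le_mul _ _
          _ = (1 + |T|) ^ ε * (1 + |z.im - T|) ^ ε :=
              Real.mul_rpow (by positivity) (by positivity)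
          _ ≤ (1 + |T|) ^ ε * (1 + |z.im - T|) ^ (1 : ℝ) := by
              gcongr
              linarith [abs_nonneg (z.im - T)]
          _ = _ := by rw [Real.rpow_one]
      calc _ ≤ B * (1 + |z.im|) ^ ε * Real.exp (z.re ^ 2 - (z.im - T) ^ 2) := by
            gcongr
            exact hB z hz1
        _ ≤ B * ((1 + |T|) ^ ε * (1 + |z.im - T|)) * Real.exp (z.re ^ 2 - (z.im - T) ^ 2) := by
            gcongr
        _ = B * (1 + |T|) ^ ε * ((1 + |z.im - T|) * Real.exp (z.re ^ 2 - (z.im - T) ^ 2)) := by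
            ring
        _ ≤ (A + B) * (1 + |T|) ^ ε * Real.exp 4 := by
            gcongr
            · linarith
            · exact one_add_mul_exp_le (hsq _ (by linarith) (by linarith))
        _ = _ := by ring)
  have hD : 0 < D := by positivity
  rw [norm_mul, norm_exp_sub_mul_I_sq] at hmain
  calc ‖DirichletCharacter.LFunction χ s‖ ≤
        ‖DirichletCharacter.LFunction χ s‖ * Real.exp (s.re ^ 2 - (s.im - T) ^ 2) := by
        apply le_mul_of_one_le_right (norm_nonneg _)
        rw [sub_self]
        exact Real.one_le_exp (by nlinarith [sq_nonneg s.re])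
    _ ≤ (D * (1 + |T|)) ^ (1 - w) * (D * (1 + |T|) ^ ε) ^ w := hmain
    _ = D * (1 + |T|) ^ (1 - w + ε * w) := by
        rw [Real.mul_rpow hD.le (by positivity), Real.mul_rpow hD.le (by positivity),
          ← Real.rpow_mul (by positivity), Real.rpow_add (by positivity)]
        rw [show D ^ (1 - w) * (1 + |T|) ^ (1 - w) * (D ^ w * (1 + |T|) ^ (ε * w)) =
          (D ^ (1 - w) * D ^ w) * ((1 + |T|) ^ (1 - w) * (1 + |T|) ^ (ε * w)) by ring,
          ← Real.rpow_add hD, sub_add_cancel, Real.rpow_one]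
    _ ≤ _ := by
        gcongr
        · linarith
        · nlinarith

lemma exists_norm_LFunction_le_near_critical_line {N : ℕ} [NeZero N]
    {χ : DirichletCharacter ℂ N} (hχ : χ ≠ 1)
    (hz : ∀ s : ℂ, 1 / 2 < s.re → DirichletCharacter.LFunction χ s ≠ 0) {c ε : ℝ}
    (hc : c ≤ 1 / 2) (hε : 0 < ε) :
    ∃ η C : ℝ, 0 < η ∧ η < 1 ∧ 0 < C ∧ ∀ s : ℂ, 1 / 2 - c - η ≤ s.re → s.re ≤ 1 / 2 + η →
      ‖DirichletCharacter.LFunction χ s‖ ≤ C * (1 + |s.im|) ^ (c + ε) := by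
  set η := min ε 1 / 4
  have h0 : 0 < min ε 1 := lt_min hε one_pos
  have h1 : min ε 1 ≤ 1 := min_le_right _ _
  have h2 : min ε 1 ≤ ε := min_le_left _ _
  have hη : 0 < η := by positivity
  have hη1 : η ≤ 1 / 4 := by simp only [η]; linarith
  obtain ⟨C, hC0, hC⟩ := exists_norm_LFunction_le_rpow_of_le_re hχ hz hη (by linarith) hη
    (by linarith)
  refine ⟨η, C, hη, by linarith, hC0, fun s hs hs' => (hC s (by linarith) hs').trans ?_⟩
  have h3 : 4 * η ≤ ε := by simp only [η]; linarith
  gcongr 2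
  · linarith [abs_nonneg s.im]
  · linarith

lemma exists_norm_LFunction_le_mul_norm_sub_zero {N : ℕ} [NeZero N]
    {χ : DirichletCharacter ℂ N} (hχ : χ ≠ 1)
    (hz : ∀ s : ℂ, 1 / 2 < s.re → DirichletCharacter.LFunction χ s ≠ 0) {c ε : ℝ}
    (hc0 : 0 < c) (hc : c ≤ 1 / 2) (hε : 0 < ε) :
    ∃ η C : ℝ, 0 < η ∧ 0 < C ∧ ∀ γ : ℝ,
      DirichletCharacter.LFunction χ (1 / 2 + γ * I) = 0 → ∀ s : ℂ,
        (‖s - (1 / 2 + γ * I)‖ < η ∨ s.im = γ ∧ 1 / 2 - c ≤ s.re ∧ s.re ≤ 1 / 2) →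
          ‖DirichletCharacter.LFunction χ s‖ ≤
            C * (|γ| + 1) ^ (c + ε) * ‖s - (1 / 2 + γ * I)‖ := by
  obtain ⟨η, C, hη, hη1, hC0, hC⟩ := exists_norm_LFunction_le_near_critical_line hχ hz hc hε
  have hd : Differentiable ℂ (DirichletCharacter.LFunction χ) :=
    DirichletCharacter.differentiable_LFunction hχ
  refine ⟨η, C * 2 ^ (c + ε) / η, hη, by positivity, fun γ hγ s hs => ?_⟩
  set ρ : ℂ := 1 / 2 + γ * I
  have hρre : ρ.re = 1 / 2 := by simp [ρ]
  have hρim : ρ.im = γ := by simp [ρ]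
  have hbd : ∀ z : ℂ, 1 / 2 - c - η ≤ z.re → z.re ≤ 1 / 2 + η → |z.im| ≤ |γ| + 1 →
      ‖DirichletCharacter.LFunction χ z‖ ≤ C * 2 ^ (c + ε) * (|γ| + 1) ^ (c + ε) := by
    intro z h1 h2 h3
    refine (hC z h1 h2).trans ?_
    rw [mul_assoc, ← Real.mul_rpow (by norm_num) (by positivity)]
    gcongr
    linarith [abs_nonneg γ]
  by_cases hs' : ‖s - ρ‖ < η
  · have h := Complex.dist_le_div_mul_dist_of_mapsTo_ball (f := DirichletCharacter.LFunction χ)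
      (c := ρ) (z := s) (R₁ := η) (R₂ := C * 2 ^ (c + ε) * (|γ| + 1) ^ (c + ε))
      hd.differentiableOn (fun z hzm => by
        rw [mem_ball_iff_norm] at hzm
        rw [hγ, mem_closedBall_zero_iff]
        have h1 := abs_lt.1 ((Complex.abs_re_le_norm _).trans_lt hzm)
        have h2 := (Complex.abs_im_le_norm _).trans_lt hzm
        rw [Complex.sub_re, hρre] at h1
        rw [Complex.sub_im, hρim] at h2
        refine hbd z (by linarith [h1.1]) (by linarith [h1.2]) ?_
        have := abs_add_le γ (z.im - γ)
        rw [add_sub_cancel] at this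
        linarith) (mem_ball_iff_norm.2 hs')
    rw [hγ, dist_zero_right, dist_eq_norm] at h
    refine h.trans_eq ?_
    ring
  · obtain ⟨h1, h2, h3⟩ := hs.resolve_left hs'
    have h4 : 1 ≤ ‖s - ρ‖ / η := (one_le_div hη).2 (not_lt.1 hs')
    calc _ ≤ C * 2 ^ (c + ε) * (|γ| + 1) ^ (c + ε) :=
          hbd s (by linarith) (by linarith) (by rw [h1]; linarith)
      _ ≤ C * 2 ^ (c + ε) * (|γ| + 1) ^ (c + ε) * (‖s - ρ‖ / η) :=
          le_mul_of_one_le_right (by positivity) h4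
      _ = _ := by ring

lemma norm_log_le_abs_log_norm_add_pi (z : ℂ) :
    ‖Complex.log z‖ ≤ |Real.log ‖z‖| + Real.pi := by
  refine (Complex.norm_le_abs_re_add_abs_im _).trans ?_
  rw [Complex.log_re, Complex.log_im]
  gcongr
  exact Complex.abs_arg_le_pi z

lemma continuousAt_norm_log {z : ℂ} (hz : z ≠ 0) : ContinuousAt (fun z => ‖Complex.log z‖) z := by
  have h1 : ContinuousAt (fun w : ℂ => |w.arg|) z := by
    have h2 : ContinuousAt (fun w : ℂ => InnerProductGeometry.angle (1 : ℂ) w) z :=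
      (InnerProductGeometry.continuousAt_angle (x := ((1 : ℂ), z)) one_ne_zero hz).comp
        (f := fun w : ℂ => ((1 : ℂ), w)) (by fun_prop)
    refine h2.congr ?_
    filter_upwards [isOpen_ne.mem_nhds hz] with w hw
    exact Complex.angle_one_left hw
  have h3 : (fun w : ℂ => ‖Complex.log w‖) =
      fun w => Real.sqrt (Real.log ‖w‖ ^ 2 + |w.arg| ^ 2) := by
    funext w
    rw [Complex.norm_eq_sqrt_sq_add_sq, Complex.log_re, Complex.log_im, sq_abs]
  rw [h3]
  exact (((continuousAt_id.norm.log (norm_ne_zero_iff.2 hz)).pow 2).add (h1.pow 2)).sqrt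

lemma hankelAbsIntegral_eq {g : ℂ → ℝ} {ρ : ℂ} {c r : ℝ} (hr : 0 < r) (hrc : r ≤ c)
    (hg : ∀ s, s ≠ ρ → ContinuousAt g s) :
    hankelAbsIntegral g ρ c r = 2 * (∫ σ in (ρ.re - c)..(ρ.re - r), g (σ + ρ.im * I)) +
      ∫ θ in (-Real.pi)..Real.pi, g (ρ + r * Complex.exp (θ * I)) * r := by
  set J : ℝ → ℝ := fun ε => ∫ σ in (ρ.re - c)..(ρ.re - r), g (σ + (ρ.im + ε) * I)
  have hJ : Continuous J := by
    have h1 : J = fun ε : ℝ => ∫ σ in (ρ.re - c)..(ρ.re - r),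
        g ((min σ (ρ.re - r) : ℝ) + (ρ.im + ε) * I) := by
      funext ε
      refine intervalIntegral.integral_congr fun σ hσ => ?_
      rw [Set.uIcc_of_le (by linarith)] at hσ
      simp only [min_eq_left hσ.2]
    rw [h1]
    refine intervalIntegral.continuous_parametric_intervalIntegral_of_continuous' ?_ _ _
    rw [continuous_iff_continuousAt]
    rintro ⟨ε, σ⟩
    refine ContinuousAt.comp (f := fun p : ℝ × ℝ =>
      ((min p.2 (ρ.re - r) : ℝ) + (ρ.im + p.1) * I : ℂ)) (hg _ fun h => ?_) (by fun_prop)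
    have h2 := congrArg Complex.re h
    simp at h2
    linarith [min_le_right σ (ρ.re - r)]
  have hJ0 : Tendsto J (nhdsWithin 0 (Set.Ioi 0)) (nhds (J 0)) :=
    hJ.continuousAt.tendsto.mono_left nhdsWithin_le_nhds
  have hJ1 : Tendsto (fun ε => J (-ε)) (nhdsWithin 0 (Set.Ioi 0)) (nhds (J 0)) := by
    have := (hJ.comp continuous_neg).continuousAt (x := (0 : ℝ)).tendsto
    simp only [Function.comp, neg_zero] at this
    exact this.mono_left nhdsWithin_le_nhds
  have hlim := ((hJ1.add_const
    (∫ θ in (-Real.pi)..Real.pi, g (ρ + r * Complex.exp (θ * I)) * r)).add hJ0).limUnder_eq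
  have hJ00 : J 0 = ∫ σ in (ρ.re - c)..(ρ.re - r), g (σ + ρ.im * I) := by simp [J]
  rw [← hJ00, hankelAbsIntegral]
  refine Eq.trans ?_ (hlim.trans (by ring))
  simp [J, sub_eq_add_neg]

lemma log_inv_le_log_add {u L : ℝ} (hu : 0 < u) (hL : 0 < L) :
    -Real.log u ≤ Real.log L + 1 / (u * L) := by
  have h1 := Real.log_le_sub_one_of_pos (show 0 < 1 / (u * L) by positivity)
  rw [one_div, Real.log_inv, Real.log_mul hu.ne' hL.ne', ← one_div] at h1
  linarith

lemma integral_mul_add_mul_exp_le {a L b c r : ℝ} (ha : 0 ≤ a) (hL : 0 < L) (hr : 0 ≤ r)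
    (hc : 0 ≤ c) :
    ∫ σ in (b - c)..(b - r), (a * (b - σ) + 1 / L) * Real.exp (-((b - σ) * L)) ≤
      (a + 1) / L ^ 2 := by
  set P : ℝ → ℝ := fun σ =>
    (a * ((b - σ) / L + 1 / L ^ 2) + 1 / L ^ 2) * Real.exp (-((b - σ) * L))
  have hP : ∀ σ, HasDerivAt P ((a * (b - σ) + 1 / L) * Real.exp (-((b - σ) * L))) σ := by
    intro σ
    have h1 : HasDerivAt (fun σ : ℝ => b - σ) (-1) σ := by
      simpa using (hasDerivAt_id σ).const_sub b
    have h2 := ((((h1.div_const L).add_const (1 / L ^ 2)).const_mul a).add_const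
      (1 / L ^ 2)).mul (h1.mul_const L).neg.exp
    refine h2.congr_deriv ?_
    simp only [Pi.neg_apply]
    field_simp
    ring
  rw [intervalIntegral.integral_eq_sub_of_hasDerivAt (fun σ _ => hP σ)
    (Continuous.intervalIntegrable (by fun_prop) _ _)]
  have h1 : 0 ≤ P (b - c) := by
    simp only [P, sub_sub_cancel]
    positivity
  have h2 : P (b - r) ≤ (a + 1) / L ^ 2 := by
    simp only [P, sub_sub_cancel]
    have h3 : (r * L + 1) * Real.exp (-(r * L)) ≤ 1 := by
      rw [Real.exp_neg, ← div_eq_mul_inv, div_le_one (Real.exp_pos _)]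
      exact Real.add_one_le_exp _
    have h4 : Real.exp (-(r * L)) ≤ 1 := Real.exp_le_one_iff.2 (by nlinarith)
    calc _ = (a * ((r * L + 1) * Real.exp (-(r * L))) + Real.exp (-(r * L))) / L ^ 2 := by
          field_simp
      _ ≤ (a * 1 + 1) / L ^ 2 := by gcongr
      _ = _ := by ring
  linarith

lemma hankelAbsIntegral_norm_mul_norm_log_le {f : ℂ → ℂ} (hf : Continuous f) {γ c r x M : ℝ}
    (hM : 0 ≤ M) (hc : c < 1) (hr : 0 < r) (hrc : r ≤ c) (hr1 : r ≤ Real.exp (-1)) (hx : 3 ≤ x)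
    (hseg : ∀ s : ℂ, s.im = γ → 1 / 2 - c ≤ s.re → s.re ≤ 1 / 2 →
      ‖f s‖ ≤ M * ‖s - (1 / 2 + γ * I)‖)
    (hcirc : ∀ s : ℂ, ‖s - (1 / 2 + γ * I)‖ = r → ‖f s‖ ≤ M * r) :
    hankelAbsIntegral
        (fun s => ‖f s‖ * ‖Complex.log (s - (1 / 2 + γ * I))‖ * x ^ s.re) (1 / 2 + γ * I) c r ≤
      M * Real.sqrt x * (2 * ((Real.log (Real.log x) + Real.pi + 1) / Real.log x ^ 2) +
        2 * Real.pi * (1 + Real.pi) * (Real.log (1 / r) * r ^ 2 * x ^ r)) := by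
  have hx0 : 0 < x := by linarith
  have hpi := Real.pi_pos
  have hL1 : 1 < Real.log x := by
    rw [Real.lt_log_iff_exp_lt hx0]
    linarith [Real.exp_one_lt_d9]
  have hLL : 0 < Real.log (Real.log x) := Real.log_pos hL1
  have hcont : ∀ s : ℂ, s ≠ 1 / 2 + γ * I → ContinuousAt
      (fun s => ‖f s‖ * ‖Complex.log (s - (1 / 2 + γ * I))‖ * x ^ s.re) s := by
    intro s hs
    refine ((hf.norm.continuousAt).mul ?_).mul ?_
    · exact ContinuousAt.comp (f := fun s : ℂ => s - (1 / 2 + γ * I))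
        (continuousAt_norm_log (sub_ne_zero.2 hs)) (by fun_prop)
    · exact continuousAt_const.rpow Complex.continuous_re.continuousAt (Or.inl hx0.ne')
  rw [hankelAbsIntegral_eq hr hrc hcont]
  have hre : (1 / 2 + γ * I : ℂ).re = 1 / 2 := by simp
  have him : (1 / 2 + γ * I : ℂ).im = γ := by simp
  rw [hre, him]
  set L := Real.log x with hL
  have hsqrt : ∀ u : ℝ, x ^ (1 / 2 + u) = Real.sqrt x * x ^ u := by
    intro u
    rw [Real.rpow_add hx0, Real.sqrt_eq_rpow]
  have hline : ∫ σ in (1 / 2 - c)..(1 / 2 - r), (‖f (σ + γ * I)‖ *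
      ‖Complex.log (σ + γ * I - (1 / 2 + γ * I))‖ * x ^ (σ + γ * I : ℂ).re) ≤
      M * Real.sqrt x * ((Real.log L + Real.pi + 1) / L ^ 2) := by
    have h1 := integral_mul_add_mul_exp_le (a := Real.log L + Real.pi) (L := L) (b := 1 / 2)
      (c := c) (r := r) (by positivity) (by linarith) hr.le (by linarith)
    refine le_trans ?_ (mul_le_mul_of_nonneg_left h1
      (show 0 ≤ M * Real.sqrt x by positivity))
    rw [← intervalIntegral.integral_const_mul]
    refine intervalIntegral.integral_mono_on (by linarith) ?_
      (Continuous.intervalIntegrable (by fun_prop) _ _) ?_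
    · refine ContinuousOn.intervalIntegrable fun σ hσ => ?_
      rw [Set.uIcc_of_le (by linarith)] at hσ
      refine (ContinuousAt.comp (f := fun σ : ℝ => (σ + γ * I : ℂ)) (hcont _ fun h => ?_)
        (by fun_prop)).continuousWithinAt
      have := congrArg Complex.re h
      simp at this
      linarith [hσ.2]
    · intro σ hσ
      set u := 1 / 2 - σ with hu
      have hu0 : 0 < u := by linarith [hσ.2]
      have hu1 : u < 1 := by linarith [hσ.1]
      have h2 : (σ + γ * I - (1 / 2 + γ * I) : ℂ) = ((-u : ℝ) : ℂ) := by
        rw [hu]; push_cast; ring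
      have h3 : ‖(σ + γ * I - (1 / 2 + γ * I) : ℂ)‖ = u := by
        rw [h2, Complex.norm_real, norm_neg, Real.norm_of_nonneg hu0.le]
      have h4 := hseg (σ + γ * I) (by simp) (by simpa using hσ.1) (by simp; linarith)
      have h5 := norm_log_le_abs_log_norm_add_pi (σ + γ * I - (1 / 2 + γ * I))
      rw [h3] at h4 h5
      rw [abs_of_neg (Real.log_neg hu0 hu1)] at h5
      have h6 := log_inv_le_log_add hu0 (show 0 < L by linarith)
      have h7 : (σ + γ * I : ℂ).re = 1 / 2 + -u := by simp [hu]
      have h8 : x ^ (-u) = Real.exp (-(u * L)) := by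
        rw [Real.rpow_def_of_pos hx0, hL]; ring_nf
      rw [h7, hsqrt, h8]
      calc _ ≤ M * u * (Real.log L + 1 / (u * L) + Real.pi) *
            (Real.sqrt x * Real.exp (-(u * L))) := by
            gcongr
            linarith
        _ = _ := by
            field_simp
            ring
  have hcircle : ∫ θ in (-Real.pi)..Real.pi, (‖f (1 / 2 + γ * I + r * Complex.exp (θ * I))‖ *
      ‖Complex.log (1 / 2 + γ * I + r * Complex.exp (θ * I) - (1 / 2 + γ * I))‖ *
      x ^ (1 / 2 + γ * I + r * Complex.exp (θ * I)).re) * r ≤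
      M * Real.sqrt x * (2 * Real.pi * (1 + Real.pi) * (Real.log (1 / r) * r ^ 2 * x ^ r)) := by
    have hlog : 1 ≤ Real.log (1 / r) := by
      rw [one_div, Real.log_inv]
      have := Real.log_le_log hr hr1
      rw [Real.log_exp] at this
      linarith
    have h1 : ∀ θ ∈ Set.uIoc (-Real.pi) Real.pi,
        ‖(‖f (1 / 2 + γ * I + r * Complex.exp (θ * I))‖ *
          ‖Complex.log (1 / 2 + γ * I + r * Complex.exp (θ * I) - (1 / 2 + γ * I))‖ *
          x ^ (1 / 2 + γ * I + r * Complex.exp (θ * I)).re) * r‖ ≤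
        M * r * ((1 + Real.pi) * Real.log (1 / r)) * (Real.sqrt x * x ^ r) * r := by
      intro θ _
      rw [Real.norm_of_nonneg (by positivity)]
      have h2 : (1 / 2 + γ * I + r * Complex.exp (θ * I) - (1 / 2 + γ * I) : ℂ) =
          r * Complex.exp (θ * I) := by ring
      have h3 : ‖(r * Complex.exp (θ * I) : ℂ)‖ = r := by
        rw [norm_mul, Complex.norm_exp_ofReal_mul_I, Complex.norm_real,
          Real.norm_of_nonneg hr.le, mul_one]
      have h4 := hcirc (1 / 2 + γ * I + r * Complex.exp (θ * I)) (by rw [h2, h3])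
      have h5 := norm_log_le_abs_log_norm_add_pi (r * Complex.exp (θ * I))
      have h6 : |Real.log r| = Real.log (1 / r) := by
        rw [one_div, Real.log_inv] at hlog ⊢
        exact abs_of_nonpos (by linarith)
      rw [h3, h6] at h5
      have h7 : (1 / 2 + γ * I + r * Complex.exp (θ * I)).re ≤ 1 / 2 + r := by
        rw [Complex.add_re, hre]
        have := (Complex.re_le_norm (r * Complex.exp (θ * I) : ℂ))
        rw [h3] at this
        linarith
      rw [h2, ← hsqrt]
      gcongr
      · nlinarith
      · linarith
    refine (Real.le_norm_self _).trans
      ((intervalIntegral.norm_integral_le_of_norm_le_const h1).trans_eq ?_)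
    rw [sub_neg_eq_add, abs_of_pos (by linarith)]
    ring
  calc _ ≤ 2 * (M * Real.sqrt x * ((Real.log L + Real.pi + 1) / L ^ 2)) +
        M * Real.sqrt x * (2 * Real.pi * (1 + Real.pi) * (Real.log (1 / r) * r ^ 2 * x ^ r)) := by
        gcongr
    _ = _ := by ring

lemma exists_log_log_add_le (A : ℝ) (hA : 0 ≤ A) :
    ∃ C : ℝ, 0 < C ∧ ∀ x : ℝ, 3 ≤ x →
      0 < Real.log (Real.log x) ∧ Real.log (Real.log x) + A ≤ C * Real.log (Real.log x) := by
  have h1 : 1 < Real.log 3 := by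
    rw [Real.lt_log_iff_exp_lt (by norm_num)]
    linarith [Real.exp_one_lt_d9]
  have h2 := Real.log_pos h1
  refine ⟨1 + A / Real.log (Real.log 3), by positivity, fun x hx => ?_⟩
  have h3 : Real.log (Real.log 3) ≤ Real.log (Real.log x) :=
    Real.log_le_log (by linarith) (Real.log_le_log (by norm_num) hx)
  refine ⟨by linarith, ?_⟩
  have h4 : A ≤ A / Real.log (Real.log 3) * Real.log (Real.log x) := by
    rw [div_mul_eq_mul_div, le_div_iff₀ h2]
    gcongr
  linarith

/-- **Lemma 6.3:** absolute-value bound for the Hankel integral of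
`|L(s,χ)| |log(s-ρ)| x^{Re s}` around a non-trivial zero `ρ = 1/2 + iγ`. -/
theorem hankel_abs_log_bound
    (q : ℕ) (hq : 0 < q) (χ : DirichletCharacter ℂ q) (hχ : χ ≠ 1) (hGRH : GRH χ)
    (c : ℝ) (hc0 : 0 < c) (hc1 : c < 1 / 6) (ε : ℝ) (hε : 0 < ε) :
    ∃ C : ℝ, ∀ γ : ℝ, LVal χ (1 / 2 + γ * I) = 0 →
      ∀ x : ℝ, 3 ≤ x → ∃ r₀ : ℝ, 0 < r₀ ∧ ∀ r : ℝ, 0 < r → r < 1 → r < r₀ →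
        hankelAbsIntegral
            (fun s => ‖LVal χ s‖ * ‖Complex.log (s - (1 / 2 + γ * I))‖ * x ^ s.re)
            (1 / 2 + γ * I) c r
          ≤ C * Real.sqrt x * (|γ| + 1) ^ (c + ε) *
            (Real.log (Real.log x) / Real.log x ^ (2 : ℕ) +
              Real.log (1 / r) * r ^ (2 : ℕ) * x ^ r) := by
  have : NeZero q := ⟨hq.ne'⟩
  have hLVal : ∀ s, LVal χ s = DirichletCharacter.LFunction χ s := fun s => by
    rw [LVal, dif_neg hq.ne']
  have hpi := Real.pi_pos
  have hz : ∀ s : ℂ, 1 / 2 < s.re → DirichletCharacter.LFunction χ s ≠ 0 := by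
    intro s hs h
    rcases lt_or_ge s.re 1 with h1 | h1
    · exact hs.ne' (hGRH s (by linarith) h1 (by rw [hLVal, h]))
    · exact DirichletCharacter.LFunction_ne_zero_of_one_le_re χ (Or.inl hχ) h1 h
  obtain ⟨η, K, hη, hK, hbound⟩ :=
    exists_norm_LFunction_le_mul_norm_sub_zero hχ hz hc0 (by linarith) hε
  obtain ⟨B, hB0, hB⟩ := exists_log_log_add_le (Real.pi + 1) (by positivity)
  refine ⟨K * (2 * B + 2 * Real.pi * (1 + Real.pi)), fun γ hγ x hx =>
    ⟨min (min c η) (Real.exp (-1)), by positivity, fun r hr _ hr0 => ?_⟩⟩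
  rw [hLVal] at hγ
  simp only [hLVal]
  rw [lt_min_iff, lt_min_iff] at hr0
  obtain ⟨⟨hrc, hrη⟩, hr1⟩ := hr0
  refine (hankelAbsIntegral_norm_mul_norm_log_le (M := K * (|γ| + 1) ^ (c + ε))
    (DirichletCharacter.differentiable_LFunction hχ).continuous (by positivity) (by linarith)
    hr hrc.le hr1.le hx (fun s h1 h2 h3 => hbound γ hγ s (Or.inr ⟨h1, h2, h3⟩))
    (fun s hs => (hbound γ hγ s (Or.inl (by rwa [hs]))).trans_eq (by rw [hs]))).trans ?_
  obtain ⟨hll, hll'⟩ := hB x hx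
  have hlog : 0 ≤ Real.log (1 / r) := by
    rw [one_div, Real.log_inv]
    have := Real.log_le_log hr hr1.le
    rw [Real.log_exp] at this
    linarith
  set S := Real.log (1 / r) * r ^ 2 * x ^ r
  have hS : 0 ≤ S := by positivity
  set Q := Real.log (Real.log x) / Real.log x ^ 2
  have hQ : 0 ≤ Q := by positivity
  have h1 : (Real.log (Real.log x) + Real.pi + 1) / Real.log x ^ 2 ≤ B * Q := by
    rw [← mul_div_assoc]
    gcongr
    linarith
  calc _ ≤ K * (|γ| + 1) ^ (c + ε) * Real.sqrt x *
        (2 * (B * Q) + 2 * Real.pi * (1 + Real.pi) * S) := by gcongr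
    _ ≤ K * (|γ| + 1) ^ (c + ε) * Real.sqrt x *
        ((2 * B + 2 * Real.pi * (1 + Real.pi)) * (Q + S)) := by
        gcongr
        nlinarith [mul_nonneg hB0.le hS,
          mul_nonneg (show 0 ≤ Real.pi * (1 + Real.pi) by positivity) hQ]
    _ = _ := by ring

end
end
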